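/- Let n ≥ 1, 0 < s < 1, 1 ≤ p < ∞, and let F be a finite-dimensional real inner product space. There exists a constant C = C(n,s,p) > 0 such that for every connection form Γ ∈ C¹ on the closed half-space ℝⁿ × [0,∞) ⊆ ℝ^{n+1} with values in L(ℝ^{n+1}, o(F)), every β ≥ ‖K_Γ‖_∞, and every C¹ map U : ℝⁿ × [0,∞) → F with compact support: ∬_{ℝⁿ×ℝⁿ} ‖U(x,0) − R^{Γ∥}(x,y) U(y,0)‖^p / |x−y|^{n+sp} dx dy ≤ C ∫_{ℝⁿ×(0,∞)} (‖D_Γ U(z)‖^p + β^{p/2} ‖U(z)‖^p) / z_{n+1}^{1−(1−s)p} dz, where z = (z', z_{n+1}) and ‖D_Γ U(z)‖ is the Hilbert–Schmidt norm of D_Γ U(z) ∈ L(ℝ^{n+1}, F). -/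

import Mathlib

set_option synthInstance.maxHeartbeats 1000000
set_option maxHeartbeats 1000000

open Set MeasureTheory
open scoped RealInnerProductSpace ENNReal

/-- The point `(x, t) ∈ ℝⁿ × ℝ ≅ ℝ^{n+1}`. -/
noncomputable def emb {n : ℕ} (x : EuclideanSpace ℝ (Fin n)) (t : ℝ) :
    EuclideanSpace ℝ (Fin (n + 1)) :=
  (EuclideanSpace.equiv (Fin (n + 1)) ℝ).symm
    (Fin.snoc ((EuclideanSpace.equiv (Fin n) ℝ) x) t)

/-- The Hilbert–Schmidt (Frobenius) norm of a continuous linear map from `ℝ^m` to `F`. -/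
noncomputable def hsNorm {m : ℕ} {F : Type*} [NormedAddCommGroup F] [InnerProductSpace ℝ F]
    (T : EuclideanSpace ℝ (Fin m) →L[ℝ] F) : ℝ :=
  Real.sqrt (∑ i : Fin m, ‖T (EuclideanSpace.single i (1 : ℝ))‖ ^ 2)

/-- The closed upper half-space `ℝⁿ × [0,∞) ⊆ ℝ^{n+1}`. -/
def closedHalfSpace (n : ℕ) : Set (EuclideanSpace ℝ (Fin (n + 1))) :=
  {z | 0 ≤ z (Fin.last n)}

section Helpers
open Filter Topology


theorem skew_norm_aux {F : Type*} [NormedAddCommGroup F] [InnerProductSpace ℝ F]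
    (u u' : ℝ → F) (A : ℝ → F →L[ℝ] F) (g : ℝ → ℝ) (hg : Continuous g)
    (hu : ∀ t ∈ Icc (0:ℝ) 1, HasDerivWithinAt u (u' t) (Icc 0 1) t)
    (hA : ∀ t ∈ Icc (0:ℝ) 1, ∀ w, ⟪A t w, w⟫ = 0)
    (hb : ∀ t ∈ Icc (0:ℝ) 1, ‖u' t + A t (u t)‖ ≤ g t) (ε : ℝ) (hε : 0 < ε) :
    ∀ x ∈ Icc (0:ℝ) 1, |√(ε ^ 2 + ‖u x‖ ^ 2) - √(ε ^ 2 + ‖u 0‖ ^ 2)| ≤ ∫ t in (0:ℝ)..x, g t := by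
  have hpos : ∀ t, 0 < ε ^ 2 + ‖u t‖ ^ 2 := fun t => by positivity
  have hd : ∀ t ∈ Icc (0:ℝ) 1, HasDerivWithinAt
      (fun x => √(ε ^ 2 + ‖u x‖ ^ 2) - √(ε ^ 2 + ‖u 0‖ ^ 2))
      ((2 * ⟪u t, u' t⟫) / (2 * √(ε ^ 2 + ‖u t‖ ^ 2))) (Icc 0 1) t := by
    intro t ht
    have h1 := ((hu t ht).norm_sq).const_add (ε ^ 2)
    exact (h1.sqrt (hpos t).ne').sub_const _
  have := image_norm_le_of_norm_deriv_right_le_deriv_boundary' (a := 0) (b := 1)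
    (f := fun x => √(ε ^ 2 + ‖u x‖ ^ 2) - √(ε ^ 2 + ‖u 0‖ ^ 2))
    (f' := fun t => (2 * ⟪u t, u' t⟫) / (2 * √(ε ^ 2 + ‖u t‖ ^ 2)))
    (B := fun x => ∫ t in (0:ℝ)..x, g t) (B' := g)
    (fun t ht => (hd t ht).continuousWithinAt)
    (fun t ht => (hd t ⟨ht.1, ht.2.le⟩).mono_of_mem_nhdsWithin
      (Icc_mem_nhdsGE_of_mem ht))
    (by simp)
    (fun t _ => (hg.integral_hasStrictDerivAt 0 t).hasDerivAt.continuousAt.continuousWithinAt)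
    (fun t _ => (hg.integral_hasStrictDerivAt 0 t).hasDerivAt.hasDerivWithinAt)
    (by
      intro t ht
      have ht' : t ∈ Icc (0:ℝ) 1 := ⟨ht.1, ht.2.le⟩
      have h0 : ⟪u t, u' t⟫ = ⟪u t, u' t + A t (u t)⟫ := by
        rw [inner_add_right, real_inner_comm (A t (u t)) (u t), hA t ht', add_zero]
      have hs : ‖u t‖ ≤ √(ε ^ 2 + ‖u t‖ ^ 2) := by
        apply Real.le_sqrt_of_sq_le; nlinarith [sq_nonneg ε]
      have hs0 : 0 < √(ε ^ 2 + ‖u t‖ ^ 2) := Real.sqrt_pos.2 (hpos t)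
      have hk : |⟪u t, u' t⟫| ≤ √(ε ^ 2 + ‖u t‖ ^ 2) * g t := by
        rw [h0]
        refine (abs_real_inner_le_norm _ _).trans ?_
        exact mul_le_mul hs (hb t ht') (norm_nonneg _) hs0.le
      rw [mul_div_mul_left _ _ two_ne_zero, Real.norm_eq_abs, abs_div, abs_of_pos hs0,
        div_le_iff₀ hs0, mul_comm]
      exact hk)
  exact this

theorem skew_norm {F : Type*} [NormedAddCommGroup F] [InnerProductSpace ℝ F]
    (u u' : ℝ → F) (A : ℝ → F →L[ℝ] F) (g : ℝ → ℝ) (hg : Continuous g)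
    (hu : ∀ t ∈ Icc (0:ℝ) 1, HasDerivWithinAt u (u' t) (Icc 0 1) t)
    (hA : ∀ t ∈ Icc (0:ℝ) 1, ∀ w, ⟪A t w, w⟫ = 0)
    (hb : ∀ t ∈ Icc (0:ℝ) 1, ‖u' t + A t (u t)‖ ≤ g t) :
    ∀ x ∈ Icc (0:ℝ) 1, |‖u x‖ - ‖u 0‖| ≤ ∫ t in (0:ℝ)..x, g t := by
  intro x hx
  have hlim : Tendsto (fun ε : ℝ => |√(ε ^ 2 + ‖u x‖ ^ 2) - √(ε ^ 2 + ‖u 0‖ ^ 2)|) (𝓝[>] 0)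
      (𝓝 |√((0:ℝ) ^ 2 + ‖u x‖ ^ 2) - √((0:ℝ) ^ 2 + ‖u 0‖ ^ 2)|) := by
    have : Continuous (fun ε : ℝ => |√(ε ^ 2 + ‖u x‖ ^ 2) - √(ε ^ 2 + ‖u 0‖ ^ 2)|) := by fun_prop
    exact (this.tendsto 0).mono_left nhdsWithin_le_nhds
  have h := le_of_tendsto hlim (b := ∫ t in (0:ℝ)..x, g t) (by
    filter_upwards [self_mem_nhdsWithin] with ε hε
    exact skew_norm_aux u u' A g hg hu hA hb ε hε x hx)
  simpa using h

theorem skew_ode_exists {F : Type*} [NormedAddCommGroup F] [InnerProductSpace ℝ F]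
    [FiniteDimensional ℝ F] (B : ℝ → F →L[ℝ] F) (hB : ContinuousOn B (Icc 0 1))
    (hs : ∀ t ∈ Icc (0:ℝ) 1, ∀ w, ⟪B t w, w⟫ = 0) (a : F) :
    ∃ u : ℝ → F, u 0 = a ∧ ∀ t ∈ Icc (0:ℝ) 1,
      HasDerivWithinAt u (-(B t (u t))) (Icc 0 1) t := by
  have : CompleteSpace F := FiniteDimensional.complete ℝ F
  obtain ⟨M, hM⟩ := isCompact_Icc.exists_bound_of_continuousOn hB
  have hM0 : 0 ≤ M := (norm_nonneg _).trans (hM 0 (by simp))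
  let χ : ContDiffBump (0 : F) := ⟨‖a‖ + 1, ‖a‖ + 2, by positivity, by linarith⟩
  let ρ : F → F := fun y => χ y • y
  have hρ : ContDiff ℝ 1 ρ := (χ.contDiff).smul contDiff_id
  have hρc : HasCompactSupport ρ := χ.hasCompactSupport.smul_right
  obtain ⟨K, hK⟩ := hρ.lipschitzWith_of_hasCompactSupport hρc one_ne_zero
  obtain ⟨R, hR⟩ := hρ.continuous.bounded_above_of_compact_support hρc
  have hR0 : 0 ≤ R := (norm_nonneg _).trans (hR 0)
  have hPL : IsPicardLindelof (fun t y => -(B t (ρ y))) (tmin := 0) (tmax := 1)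
      ⟨0, by simp⟩ a (M.toNNReal * R.toNNReal) 0 (M.toNNReal * R.toNNReal) (M.toNNReal * K) := by
    constructor
    · intro t ht
      refine LipschitzOnWith.of_dist_le_mul fun x _ y _ => ?_
      rw [dist_neg_neg, dist_eq_norm, ← map_sub]
      refine ((B t).le_opNorm _).trans ?_
      have h2 := hK.dist_le_mul x y
      rw [dist_eq_norm] at h2
      push_cast
      rw [Real.coe_toNNReal _ hM0, mul_assoc]
      exact mul_le_mul (hM t ht) h2 (norm_nonneg _) hM0
    · intro x _
      exact (hB.clm_apply continuousOn_const).neg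
    · intro t ht x _
      rw [norm_neg]
      refine ((B t).le_opNorm _).trans ?_
      push_cast
      rw [Real.coe_toNNReal _ hM0, Real.coe_toNNReal _ hR0]
      exact mul_le_mul (hM t ht) (hR x) (norm_nonneg _) hM0
    · simp
  obtain ⟨u, hu0, hu⟩ := hPL.exists_eq_forall_mem_Icc_hasDerivWithinAt₀
  refine ⟨u, hu0, fun t ht => ?_⟩
  have hn := skew_norm u _ (fun t => χ (u t) • B t) (fun _ => 0) continuous_const hu
    (by intro t ht w; simp [inner_smul_left, hs t ht w])
    (by intro t ht; simp [ρ]) t ht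
  have hn' : ‖u t‖ = ‖a‖ := by
    simp at hn
    have : u 0 = a := hu0
    rw [← this]; linarith
  have : ρ (u t) = u t := by
    have : χ (u t) = 1 := χ.one_of_mem_closedBall (by
      simp only [mem_closedBall_zero_iff, hn', χ]; linarith)
    simp [ρ, this]
  have h := hu t ht
  rwa [this] at h


theorem unif_taylor {G : Type*} [NormedAddCommGroup G] [NormedSpace ℝ G]
    (B dB : ℝ → ℝ → G)
    (hdB : ∀ r ∈ Icc (0:ℝ) 1, ∀ t ∈ Icc (0:ℝ) 1,
      HasDerivWithinAt (fun τ => B r τ) (dB r t) (Icc 0 1) t)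
    (hdBc : ContinuousOn (fun q : ℝ × ℝ => dB q.1 q.2) (Icc 0 1 ×ˢ Icc 0 1))
    (t : ℝ) (ht : t ∈ Icc (0:ℝ) 1) (ε : ℝ) (hε : 0 < ε) :
    ∀ᶠ t2 in 𝓝[Icc 0 1] t, ∀ r ∈ Icc (0:ℝ) 1,
      ‖B r t2 - B r t - (t2 - t) • dB r t‖ ≤ ε * |t2 - t| := by
  have huc := (isCompact_Icc.prod isCompact_Icc).uniformContinuousOn_of_continuous hdBc
  rw [Metric.uniformContinuousOn_iff] at huc
  obtain ⟨η, hη, h⟩ := huc ε hε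
  have hev : ∀ᶠ t2 in 𝓝[Icc 0 1] t, t2 ∈ Metric.ball t η ∩ Icc 0 1 :=
    inter_mem (nhdsWithin_le_nhds (Metric.ball_mem_nhds t hη)) self_mem_nhdsWithin
  filter_upwards [hev] with t2 ht2 r hr
  have hconv : Convex ℝ (Metric.ball t η ∩ Icc (0:ℝ) 1) := (convex_ball t η).inter (convex_Icc 0 1)
  have := hconv.norm_image_sub_le_of_norm_hasDerivWithin_le (C := ε)
    (f := fun τ => B r τ - (τ - t) • dB r t) (f' := fun τ => dB r τ - dB r t)
    (x := t) (y := t2)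
    (by
      intro τ hτ
      have h1 := (hdB r hr τ hτ.2).mono (inter_subset_right : Metric.ball t η ∩ Icc (0:ℝ) 1 ⊆ _)
      have h2 : HasDerivWithinAt (fun τ : ℝ => (τ - t) • dB r t) ((1:ℝ) • dB r t)
          (Metric.ball t η ∩ Icc (0:ℝ) 1) τ :=
        ((hasDerivWithinAt_id τ _).sub_const t).smul_const (dB r t)
      have h3 := h1.sub h2
      rw [one_smul] at h3
      exact h3)
    (by
      intro τ hτ
      have := h (r, τ) ⟨hr, hτ.2⟩ (r, t) ⟨hr, ht⟩ (by
        simpa [Prod.dist_eq, hη] using hτ.1)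
      rw [dist_eq_norm] at this
      exact this.le)
    ⟨Metric.mem_ball_self hη, ht⟩ ht2
  rw [Real.norm_eq_abs] at this
  convert this using 2
  simp; abel

theorem holonomy_local {F : Type*} [NormedAddCommGroup F] [InnerProductSpace ℝ F]
    (A B dA dB : ℝ → ℝ → F →L[ℝ] F) (φ : ℝ → F) (u : ℝ → ℝ → F) (κ m : ℝ)
    (hBs : ∀ r ∈ Icc (0:ℝ) 1, ∀ t ∈ Icc (0:ℝ) 1, ∀ w, ⟪B r t w, w⟫ = 0)
    (hdA : ∀ r ∈ Icc (0:ℝ) 1, ∀ t ∈ Icc (0:ℝ) 1,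
      HasDerivWithinAt (fun ρ => A ρ t) (dA r t) (Icc 0 1) r)
    (hdB : ∀ r ∈ Icc (0:ℝ) 1, ∀ t ∈ Icc (0:ℝ) 1,
      HasDerivWithinAt (fun τ => B r τ) (dB r t) (Icc 0 1) t)
    (hdBc : ContinuousOn (fun q : ℝ × ℝ => dB q.1 q.2) (Icc 0 1 ×ˢ Icc 0 1))
    (hκ : ∀ r ∈ Icc (0:ℝ) 1, ∀ t ∈ Icc (0:ℝ) 1,
      ‖dB r t - dA r t + (A r t).comp (B r t) - (B r t).comp (A r t)‖ ≤ κ)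
    (hA1 : ∀ t ∈ Icc (0:ℝ) 1, A 1 t = 0)
    (hφ : ∀ t ∈ Icc (0:ℝ) 1, HasDerivWithinAt φ (-(A 0 t (φ t))) (Icc 0 1) t)
    (hu0 : ∀ t ∈ Icc (0:ℝ) 1, u t 0 = φ t)
    (hu : ∀ t ∈ Icc (0:ℝ) 1, ∀ r ∈ Icc (0:ℝ) 1,
      HasDerivWithinAt (u t) (-(B r t (u t r))) (Icc 0 1) r)
    (hm : ∀ t ∈ Icc (0:ℝ) 1, ∀ r ∈ Icc (0:ℝ) 1, ‖u t r‖ ≤ m)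
    (t : ℝ) (ht : t ∈ Icc (0:ℝ) 1) (ε : ℝ) (hε : 0 < ε) :
    ∀ᶠ t2 in 𝓝[Icc 0 1] t, ‖u t2 1 - u t 1‖ ≤ (κ * m + ε) * |t2 - t| := by
  have z0 : (0:ℝ) ∈ Icc (0:ℝ) 1 := by simp
  have z1 : (1:ℝ) ∈ Icc (0:ℝ) 1 := by simp
  have hm0 : 0 ≤ m := (norm_nonneg _).trans (hm 0 z0 0 z0)
  have hκ0 : 0 ≤ κ := (norm_nonneg _).trans (hκ 0 z0 0 z0)
  obtain ⟨MA, hMA⟩ := isCompact_Icc.exists_bound_of_continuousOn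
    (fun r hr => (hdA r hr t ht).continuousWithinAt)
  have hMA0 : 0 ≤ MA := (norm_nonneg _).trans (hMA 0 z0)
  obtain ⟨Md, hMd⟩ := (isCompact_Icc.prod isCompact_Icc).exists_bound_of_continuousOn hdBc
  have hMd0 : 0 ≤ Md := (norm_nonneg _).trans (hMd (0, 0) ⟨z0, z0⟩)
  set ε1 : ℝ := ε / (2 * (m + 1)) with hε1
  have hε1p : 0 < ε1 := by positivity
  have e1 := unif_taylor B dB hdB hdBc t ht ε1 hε1p
  have e2 : ∀ᶠ t2 in 𝓝[Icc 0 1] t, ‖φ t2 - φ t - (t2 - t) • (-(A 0 t (φ t)))‖ ≤ ε1 * |t2 - t| := by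
    have := (hasDerivWithinAt_iff_isLittleO.1 (hφ t ht)).def hε1p
    simpa using this
  have e3 : ∀ᶠ t2 in 𝓝[Icc 0 1] t, |t2 - t| * ((ε1 + Md) * MA * m) ≤ ε / 2 := by
    have : Tendsto (fun t2 => |t2 - t| * ((ε1 + Md) * MA * m)) (𝓝[Icc 0 1] t)
        (𝓝 (|t - t| * ((ε1 + Md) * MA * m))) := by
      have hc : Continuous (fun t2 => |t2 - t| * ((ε1 + Md) * MA * m)) := by fun_prop
      exact (hc.tendsto t).mono_left nhdsWithin_le_nhds
    simp only [sub_self, abs_zero, zero_mul] at this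
    exact this.eventually (Iic_mem_nhds (by positivity))
  filter_upwards [e1, e2, e3, self_mem_nhdsWithin] with t2 h1 h2 h3 ht2
  set δ := t2 - t with hδ
  have key := skew_norm
    (fun r => u t2 r - u t r + δ • A r t (u t r))
    (fun r => -(B r t2 (u t2 r)) - -(B r t (u t r)) +
      δ • (dA r t (u t r) + A r t (-(B r t (u t r)))))
    (fun r => B r t2)
    (fun _ => |δ| * (κ * m + ε1 * m + |δ| * ((ε1 + Md) * MA * m))) continuous_const
    (fun r hr => ((hu t2 ht2 r hr).sub (hu t ht r hr)).add
      (((hdA r hr t ht).clm_apply (hu t ht r hr)).const_smul δ))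
    (fun r hr => hBs r hr t2 ht2)
    (by
      intro r hr
      have hrw : -(B r t2 (u t2 r)) - -(B r t (u t r)) +
          δ • (dA r t (u t r) + A r t (-(B r t (u t r)))) +
          B r t2 (u t2 r - u t r + δ • A r t (u t r)) =
          -((B r t2 - B r t - δ • dB r t) (u t r)) -
          δ • ((dB r t - dA r t + (A r t).comp (B r t) - (B r t).comp (A r t)) (u t r)) +
          δ • ((B r t2 - B r t) (A r t (u t r))) := by
        simp only [map_add, map_sub, map_neg, map_smul, _root_.add_apply,
          _root_.sub_apply, _root_.smul_apply,
          ContinuousLinearMap.comp_apply]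
        module
      rw [hrw]
      have hU := hm t ht r hr
      have b1 : ‖(B r t2 - B r t - δ • dB r t) (u t r)‖ ≤ (ε1 * |δ|) * m :=
        ((ContinuousLinearMap.le_opNorm _ _)).trans
          (mul_le_mul (h1 r hr) hU (norm_nonneg _) (by positivity))
      have b2 : ‖δ • ((dB r t - dA r t + (A r t).comp (B r t) - (B r t).comp (A r t)) (u t r))‖
          ≤ |δ| * (κ * m) := by
        rw [norm_smul, Real.norm_eq_abs]
        refine mul_le_mul_of_nonneg_left ?_ (abs_nonneg _)
        exact ((ContinuousLinearMap.le_opNorm _ _)).trans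
          (mul_le_mul (hκ r hr t ht) hU (norm_nonneg _) hκ0)
      have b3' : ‖B r t2 - B r t‖ ≤ (ε1 + Md) * |δ| := by
        have : B r t2 - B r t = (B r t2 - B r t - δ • dB r t) + δ • dB r t := by abel
        rw [this]
        refine (norm_add_le _ _).trans ?_
        have hd := hMd (r, t) ⟨hr, ht⟩
        have : ‖δ • dB r t‖ ≤ |δ| * Md := by
          rw [norm_smul, Real.norm_eq_abs]
          exact mul_le_mul_of_nonneg_left hd (abs_nonneg _)
        linarith [h1 r hr]
      have b3 : ‖δ • ((B r t2 - B r t) (A r t (u t r)))‖ ≤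
          |δ| * (((ε1 + Md) * |δ|) * (MA * m)) := by
        rw [norm_smul, Real.norm_eq_abs]
        refine mul_le_mul_of_nonneg_left ?_ (abs_nonneg _)
        refine ((ContinuousLinearMap.le_opNorm _ _)).trans
          (mul_le_mul b3' ?_ (norm_nonneg _) (by positivity))
        exact ((ContinuousLinearMap.le_opNorm _ _)).trans
          (mul_le_mul (hMA r hr) hU (norm_nonneg _) hMA0)
      refine (norm_add_le _ _).trans ?_
      refine (add_le_add_left (norm_sub_le _ _) _).trans ?_
      rw [norm_neg]
      linarith)
    1 z1
  simp only [hA1 t ht, _root_.zero_apply, smul_zero, add_zero,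
    intervalIntegral.integral_const, sub_zero, one_smul, hu0 t ht, hu0 t2 ht2] at key
  have k1 := (abs_le.1 key).2
  have k2 : ‖φ t2 - φ t + δ • A 0 t (φ t)‖ ≤ ε1 * |δ| := by
    simpa [smul_neg] using h2
  have k3 : ε1 * (m + 1) = ε / 2 := by rw [hε1]; field_simp
  have k4 : |δ| * (ε1 * (m + 1)) = |δ| * (ε / 2) := by rw [k3]
  have k5 := mul_le_mul_of_nonneg_left h3 (abs_nonneg δ)
  linarith

theorem holonomy_bound {F : Type*} [NormedAddCommGroup F] [InnerProductSpace ℝ F]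
    (A B dA dB : ℝ → ℝ → F →L[ℝ] F) (φ : ℝ → F) (u : ℝ → ℝ → F) (κ : ℝ)
    (hAs : ∀ t ∈ Icc (0:ℝ) 1, ∀ w, ⟪A 0 t w, w⟫ = 0)
    (hBs : ∀ r ∈ Icc (0:ℝ) 1, ∀ t ∈ Icc (0:ℝ) 1, ∀ w, ⟪B r t w, w⟫ = 0)
    (hdA : ∀ r ∈ Icc (0:ℝ) 1, ∀ t ∈ Icc (0:ℝ) 1,
      HasDerivWithinAt (fun ρ => A ρ t) (dA r t) (Icc 0 1) r)
    (hdB : ∀ r ∈ Icc (0:ℝ) 1, ∀ t ∈ Icc (0:ℝ) 1,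
      HasDerivWithinAt (fun τ => B r τ) (dB r t) (Icc 0 1) t)
    (hdBc : ContinuousOn (fun q : ℝ × ℝ => dB q.1 q.2) (Icc 0 1 ×ˢ Icc 0 1))
    (hκ : ∀ r ∈ Icc (0:ℝ) 1, ∀ t ∈ Icc (0:ℝ) 1,
      ‖dB r t - dA r t + (A r t).comp (B r t) - (B r t).comp (A r t)‖ ≤ κ)
    (hA1 : ∀ t ∈ Icc (0:ℝ) 1, A 1 t = 0)
    (hφ : ∀ t ∈ Icc (0:ℝ) 1, HasDerivWithinAt φ (-(A 0 t (φ t))) (Icc 0 1) t)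
    (hu0 : ∀ t ∈ Icc (0:ℝ) 1, u t 0 = φ t)
    (hu : ∀ t ∈ Icc (0:ℝ) 1, ∀ r ∈ Icc (0:ℝ) 1,
      HasDerivWithinAt (u t) (-(B r t (u t r))) (Icc 0 1) r) :
    ‖u 1 1 - u 0 1‖ ≤ κ * ‖φ 0‖ := by
  have hφn : ∀ t ∈ Icc (0:ℝ) 1, ‖φ t‖ = ‖φ 0‖ := by
    intro t ht
    have := skew_norm φ _ (fun t => A 0 t) (fun _ => 0) continuous_const hφ hAs (by simp) t ht
    simp at this
    linarith
  have hun : ∀ t ∈ Icc (0:ℝ) 1, ∀ r ∈ Icc (0:ℝ) 1, ‖u t r‖ ≤ ‖φ 0‖ := by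
    intro t ht r hr
    have := skew_norm (u t) _ (fun r => B r t) (fun _ => 0) continuous_const (hu t ht)
      (fun r hr => hBs r hr t ht) (by simp) r hr
    simp at this
    rw [← hφn t ht, ← hu0 t ht]
    linarith
  have hloc := holonomy_local A B dA dB φ u κ ‖φ 0‖ hBs hdA hdB hdBc hκ hA1 hφ hu0 hu hun
  have hcont : ContinuousOn (fun t => ‖u t 1 - u 0 1‖) (Icc 0 1) := by
    have : ContinuousOn (fun t => u t 1) (Icc 0 1) := by
      intro t ht
      rw [ContinuousWithinAt, tendsto_iff_norm_sub_tendsto_zero]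
      have hc : Continuous (fun t2 => (κ * ‖φ 0‖ + 1) * |t2 - t|) := by fun_prop
      have hc' := (hc.tendsto t).mono_left (nhdsWithin_le_nhds (s := Icc 0 1))
      simp only [sub_self, abs_zero, mul_zero] at hc'
      exact squeeze_zero' (Eventually.of_forall fun _ => norm_nonneg _) (hloc t ht 1 one_pos) hc'
    exact (this.sub continuousOn_const).norm
  have := image_le_of_liminf_slope_right_le_deriv_boundary (a := 0) (b := 1) hcont
    (B := fun t => κ * ‖φ 0‖ * t) (B' := fun _ => κ * ‖φ 0‖) (by simp) (by fun_prop)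
    (fun x _ => by simpa using ((hasDerivWithinAt_id x (Ici x)).const_mul (κ * ‖φ 0‖)))
    (by
      intro t ht r hr
      have ht' : t ∈ Icc (0:ℝ) 1 := ⟨ht.1, ht.2.le⟩
      obtain ⟨ε, hε, hεr⟩ : ∃ ε > 0, κ * ‖φ 0‖ + ε < r :=
        ⟨(r - κ * ‖φ 0‖) / 2, by linarith, by linarith⟩
      have h1 : ∀ᶠ t2 in 𝓝[>] t, ‖u t2 1 - u t 1‖ ≤ (κ * ‖φ 0‖ + ε) * |t2 - t| := by
        have hle : 𝓝[>] t ≤ 𝓝[Icc 0 1] t :=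
          (nhdsWithin_mono _ Ioi_subset_Ici_self).trans
            (nhdsWithin_le_of_mem (Icc_mem_nhdsGE_of_mem ht))
        exact hle (hloc t ht' ε hε)
      refine Eventually.frequently ?_
      filter_upwards [h1, self_mem_nhdsWithin] with t2 h2 (h3 : t < t2)
      rw [slope_def_field, div_lt_iff₀ (by linarith)]
      have h4 : ‖u t2 1 - u 0 1‖ ≤ ‖u t2 1 - u t 1‖ + ‖u t 1 - u 0 1‖ := by
        simpa using norm_add_le (u t2 1 - u t 1) (u t 1 - u 0 1)
      rw [abs_of_pos (by linarith)] at h2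
      have : (κ * ‖φ 0‖ + ε) * (t2 - t) < r * (t2 - t) :=
        mul_lt_mul_of_pos_right hεr (by linarith)
      linarith)
    (show (1:ℝ) ∈ Icc (0:ℝ) 1 by simp)
  simpa using this


theorem chain_G {E G : Type*} [NormedAddCommGroup E] [NormedSpace ℝ E] [NormedAddCommGroup G]
  [NormedSpace ℝ G] (f : E → G) (f' : E →L[ℝ] G) (S : Set E) (c : ℝ → E) (e : E) (s : Set ℝ) (r : ℝ)
  (hf : HasFDerivWithinAt f f' S (c r)) (hc : HasDerivAt c e r) (hm : ∀ t ∈ s, c t ∈ S) :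
  HasDerivWithinAt (fun ρ => f (c ρ)) (f' e) s r :=
  hf.comp_hasDerivWithinAt r hc.hasDerivWithinAt hm

section Emb
variable {n : ℕ}

theorem emb_last (x : EuclideanSpace ℝ (Fin n)) (t : ℝ) : emb x t (Fin.last n) = t := by
  simp [emb]

theorem emb_castSucc (x : EuclideanSpace ℝ (Fin n)) (t : ℝ) (i : Fin n) :
    emb x t i.castSucc = x i := by
  simp [emb]

theorem emb_add (x y : EuclideanSpace ℝ (Fin n)) (s t : ℝ) :
    emb (x + y) (s + t) = emb x s + emb y t := by
  ext i
  refine Fin.lastCases ?_ (fun i => ?_) i <;> simp [emb_last, emb_castSucc]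

theorem emb_smul (c : ℝ) (x : EuclideanSpace ℝ (Fin n)) (t : ℝ) :
    emb (c • x) (c * t) = c • emb x t := by
  ext i
  refine Fin.lastCases ?_ (fun i => ?_) i <;> simp [emb_last, emb_castSucc]

theorem norm_emb_sq (x : EuclideanSpace ℝ (Fin n)) (t : ℝ) :
    ‖emb x t‖ ^ 2 = ‖x‖ ^ 2 + t ^ 2 := by
  rw [EuclideanSpace.norm_sq_eq, EuclideanSpace.norm_sq_eq, Fin.sum_univ_castSucc]
  simp [emb_last, emb_castSucc]

theorem norm_emb_le (x : EuclideanSpace ℝ (Fin n)) (t : ℝ) : ‖emb x t‖ ≤ ‖x‖ + |t| := by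
  apply le_of_sq_le_sq _ (by positivity)
  rw [norm_emb_sq]
  nlinarith [norm_nonneg x, abs_nonneg t, sq_abs t, mul_nonneg (norm_nonneg x) (abs_nonneg t)]

theorem continuous_emb : Continuous (fun q : EuclideanSpace ℝ (Fin n) × ℝ => emb q.1 q.2) := by
  let L : (EuclideanSpace ℝ (Fin n) × ℝ) →ₗ[ℝ] EuclideanSpace ℝ (Fin (n + 1)) :=
    { toFun := fun q => emb q.1 q.2
      map_add' := fun a b => emb_add _ _ _ _
      map_smul' := fun c a => emb_smul _ _ _ }
  exact L.continuous_of_finiteDimensional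

theorem emb_mem (x : EuclideanSpace ℝ (Fin n)) (t : ℝ) (ht : 0 ≤ t) :
    emb x t ∈ closedHalfSpace n := by
  simpa [closedHalfSpace, emb_last] using ht

theorem hasDerivAt_emb_line (x w : EuclideanSpace ℝ (Fin n)) (a τ r : ℝ) :
    HasDerivAt (fun r : ℝ => emb (x + r • w) (a + r * τ)) (emb w τ) r := by
  have h : (fun r : ℝ => emb (x + r • w) (a + r * τ)) = fun r => emb x a + r • emb w τ := by
    funext r
    rw [emb_add, emb_smul]
  rw [h]
  simpa using ((hasDerivAt_id r).smul_const (emb w τ)).const_add (emb x a)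

theorem le_hsNorm {m : ℕ} {F : Type*} [NormedAddCommGroup F] [InnerProductSpace ℝ F]
    (T : EuclideanSpace ℝ (Fin m) →L[ℝ] F) (v : EuclideanSpace ℝ (Fin m)) :
    ‖T v‖ ≤ hsNorm T * ‖v‖ := by
  have hv : v = ∑ i, v i • EuclideanSpace.single i (1:ℝ) := by
    ext j
    simp [Finset.sum_apply, Pi.single_apply]
  have h1 : ‖T v‖ ≤ ∑ i, ‖T (EuclideanSpace.single i (1 : ℝ))‖ * |v i| := by
    conv_lhs => rw [hv, map_sum]
    refine (norm_sum_le _ _).trans (Finset.sum_le_sum fun i _ => ?_)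
    rw [map_smul, norm_smul, Real.norm_eq_abs, mul_comm]
  refine h1.trans ?_
  have h2 := Real.sum_mul_le_sqrt_mul_sqrt Finset.univ
    (fun i => ‖T (EuclideanSpace.single i (1 : ℝ))‖) (fun i => |v i|)
  refine h2.trans (le_of_eq ?_)
  rw [hsNorm, EuclideanSpace.norm_eq]
  simp

theorem continuous_hsNorm {m : ℕ} {F : Type*} [NormedAddCommGroup F] [InnerProductSpace ℝ F] :
    Continuous (hsNorm (m := m) (F := F)) := by
  unfold hsNorm
  fun_prop

theorem continuous_comp_emb_abs {G : Type*} [TopologicalSpace G]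
    {f : EuclideanSpace ℝ (Fin (n + 1)) → G} (hf : ContinuousOn f (closedHalfSpace n)) :
    Continuous (fun q : EuclideanSpace ℝ (Fin n) × ℝ => f (emb q.1 |q.2|)) := by
  apply hf.comp_continuous
  · exact continuous_emb.comp (f := fun q : EuclideanSpace ℝ (Fin n) × ℝ => (q.1, |q.2|)) (by fun_prop)
  · intro q
    exact emb_mem _ _ (abs_nonneg _)

end Emb

/-- Energy density extended evenly. -/
noncomputable def gDens {n : ℕ} {F : Type*} [NormedAddCommGroup F] [InnerProductSpace ℝ F]
    (Γ : EuclideanSpace ℝ (Fin (n + 1)) → EuclideanSpace ℝ (Fin (n + 1)) →L[ℝ] F →L[ℝ] F)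
    (U : EuclideanSpace ℝ (Fin (n + 1)) → F)
    (DU : EuclideanSpace ℝ (Fin (n + 1)) → EuclideanSpace ℝ (Fin (n + 1)) →L[ℝ] F)
    (q : EuclideanSpace ℝ (Fin n) × ℝ) : ℝ :=
  hsNorm (DU (emb q.1 |q.2|) + (Γ (emb q.1 |q.2|)).flip (U (emb q.1 |q.2|)))

section Geo
variable {n : ℕ} {F : Type*} [NormedAddCommGroup F] [InnerProductSpace ℝ F]

theorem continuous_gDens
    (Γ : EuclideanSpace ℝ (Fin (n + 1)) → EuclideanSpace ℝ (Fin (n + 1)) →L[ℝ] F →L[ℝ] F)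
    (U : EuclideanSpace ℝ (Fin (n + 1)) → F)
    (DU : EuclideanSpace ℝ (Fin (n + 1)) → EuclideanSpace ℝ (Fin (n + 1)) →L[ℝ] F)
    (hΓ : ContinuousOn Γ (closedHalfSpace n)) (hU : ContinuousOn U (closedHalfSpace n))
    (hDU : ContinuousOn DU (closedHalfSpace n)) : Continuous (gDens Γ U DU) := by
  unfold gDens
  apply continuous_hsNorm.comp
  apply (continuous_comp_emb_abs hDU).add
  have h1 := continuous_comp_emb_abs hΓ
  have h2 := continuous_comp_emb_abs hU
  have h3 : Continuous (fun q : EuclideanSpace ℝ (Fin n) × ℝ => (Γ (emb q.1 |q.2|)).flip) :=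
    (ContinuousLinearMap.flipₗᵢ ℝ _ F F).continuous.comp h1
  exact h3.clm_apply h2

theorem seg_bound
    (Γ : EuclideanSpace ℝ (Fin (n + 1)) → EuclideanSpace ℝ (Fin (n + 1)) →L[ℝ] F →L[ℝ] F)
    (U : EuclideanSpace ℝ (Fin (n + 1)) → F)
    (DU : EuclideanSpace ℝ (Fin (n + 1)) → EuclideanSpace ℝ (Fin (n + 1)) →L[ℝ] F)
    (hΓ : ContinuousOn Γ (closedHalfSpace n))
    (hsk : ∀ z ∈ closedHalfSpace n, ∀ (v : EuclideanSpace ℝ (Fin (n + 1))) (w : F),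
      ⟪(Γ z v) w, w⟫ = 0)
    (hU : ∀ z ∈ closedHalfSpace n, HasFDerivWithinAt U (DU z) (closedHalfSpace n) z)
    (hDU : ContinuousOn DU (closedHalfSpace n))
    (x w : EuclideanSpace ℝ (Fin n)) (τ : ℝ) (hτ : 0 ≤ τ) (u : ℝ → F)
    (hu : ∀ r ∈ Icc (0:ℝ) 1, HasDerivWithinAt u
      (-(Γ (emb (x + r • w) (r * τ)) (emb w τ) (u r))) (Icc 0 1) r) :
    |‖U (emb (x + w) τ) - u 1‖ - ‖U (emb x 0) - u 0‖| ≤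
      ∫ r in (0:ℝ)..1, gDens Γ U DU (x + r • w, r * τ) * ‖emb w τ‖ := by
  have hUc : ContinuousOn U (closedHalfSpace n) := fun z hz => (hU z hz).continuousWithinAt
  have hg := continuous_gDens Γ U DU hΓ hUc hDU
  have hd : ∀ r ∈ Icc (0:ℝ) 1, HasDerivWithinAt (fun r : ℝ => U (emb (x + r • w) (r * τ)))
      (DU (emb (x + r • w) (r * τ)) (emb w τ)) (Icc 0 1) r := by
    intro r hr
    have h1 : HasDerivAt (fun r : ℝ => emb (x + r • w) (r * τ)) (emb w τ) r := by
      simpa using hasDerivAt_emb_line x w 0 τ r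
    exact (hU _ (emb_mem _ _ (mul_nonneg hr.1 hτ))).comp_hasDerivWithinAt r h1.hasDerivWithinAt
      (fun r' hr' => emb_mem _ _ (mul_nonneg hr'.1 hτ))
  have := skew_norm (fun r : ℝ => U (emb (x + r • w) (r * τ)) - u r) _
    (fun r => Γ (emb (x + r • w) (r * τ)) (emb w τ))
    (fun r => gDens Γ U DU (x + r • w, r * τ) * ‖emb w τ‖)
    (by fun_prop)
    (fun r hr => (hd r hr).sub (hu r hr))
    (fun r hr => hsk _ (emb_mem _ _ (mul_nonneg hr.1 hτ)) _)
    (by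
      intro r hr
      have hr' : |r * τ| = r * τ := abs_of_nonneg (mul_nonneg hr.1 hτ)
      have := le_hsNorm (DU (emb (x + r • w) (r * τ)) +
        (Γ (emb (x + r • w) (r * τ))).flip (U (emb (x + r • w) (r * τ)))) (emb w τ)
      simp only [gDens, hr']
      refine le_trans (le_of_eq ?_) this
      congr 1
      simp only [map_sub, _root_.add_apply, ContinuousLinearMap.flip_apply]
      abel)
    1 (by simp)
  simpa using this

theorem pointwise_bound [FiniteDimensional ℝ F]
    (Γ : EuclideanSpace ℝ (Fin (n + 1)) → EuclideanSpace ℝ (Fin (n + 1)) →L[ℝ] F →L[ℝ] F)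
    (DΓ : EuclideanSpace ℝ (Fin (n + 1)) →
          EuclideanSpace ℝ (Fin (n + 1)) →L[ℝ] EuclideanSpace ℝ (Fin (n + 1)) →L[ℝ] F →L[ℝ] F)
    (hdΓ : ∀ z ∈ closedHalfSpace n, HasFDerivWithinAt Γ (DΓ z) (closedHalfSpace n) z)
    (hΓ : ContinuousOn Γ (closedHalfSpace n))
    (hDΓ : ContinuousOn DΓ (closedHalfSpace n))
    (hsk : ∀ z ∈ closedHalfSpace n, ∀ (v : EuclideanSpace ℝ (Fin (n + 1))) (w : F),
      ⟪(Γ z v) w, w⟫ = 0)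
    (β : ℝ) (hβ : 0 ≤ β)
    (hK : ∀ z ∈ closedHalfSpace n, ∀ v w : EuclideanSpace ℝ (Fin (n + 1)),
          ‖((DΓ z) v) w - ((DΓ z) w) v
            + ((Γ z) v).comp ((Γ z) w) - ((Γ z) w).comp ((Γ z) v)‖ ≤ β * ‖v‖ * ‖w‖)
    (U : EuclideanSpace ℝ (Fin (n + 1)) → F)
    (DU : EuclideanSpace ℝ (Fin (n + 1)) → EuclideanSpace ℝ (Fin (n + 1)) →L[ℝ] F)
    (hU : ∀ z ∈ closedHalfSpace n, HasFDerivWithinAt U (DU z) (closedHalfSpace n) z)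
    (hDU : ContinuousOn DU (closedHalfSpace n))
    (x v : EuclideanSpace ℝ (Fin n)) (P : ℝ → F →L[ℝ] F)
    (hP1 : P 1 = ContinuousLinearMap.id ℝ F)
    (hP : ∀ t ∈ Icc (0:ℝ) 1, HasDerivWithinAt P
            (-((Γ (emb (x + t • v) 0)) (emb v 0)).comp (P t)) (Icc (0:ℝ) 1) t) :
    ‖U (emb x 0) - P 0 (U (emb (x + v) 0))‖ ≤
      6 * (‖v‖ * (∫ r in (0:ℝ)..1, gDens Γ U DU (x + r • ((1/2:ℝ) • v), r * ‖v‖)) +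
        ‖v‖ * (∫ r in (0:ℝ)..1, gDens Γ U DU (x + v + r • ((-1/2:ℝ) • v), r * ‖v‖)) +
        √β * ‖v‖ * ‖U (emb (x + (1/2:ℝ) • v) ‖v‖)‖) := by
  set h := ‖v‖ with hh
  have hh0 : 0 ≤ h := norm_nonneg v
  have z0 : (0:ℝ) ∈ Icc (0:ℝ) 1 := by simp
  have z1 : (1:ℝ) ∈ Icc (0:ℝ) 1 := by simp
  let c : ℝ → ℝ → EuclideanSpace ℝ (Fin (n + 1)) := fun r t =>
    emb ((x + t • v) + r • ((1/2 - t) • v)) (r * h)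
  let e : ℝ → EuclideanSpace ℝ (Fin (n + 1)) := fun t => emb ((1/2 - t) • v) h
  let w : ℝ → EuclideanSpace ℝ (Fin (n + 1)) := fun r => emb ((1 - r) • v) 0
  have hcm : ∀ r ∈ Icc (0:ℝ) 1, ∀ t, c r t ∈ closedHalfSpace n :=
    fun r hr t => emb_mem _ _ (mul_nonneg hr.1 hh0)
  have hcr : ∀ r t, HasDerivAt (fun ρ => c ρ t) (e t) r := fun r t => by
    simpa [c, e] using hasDerivAt_emb_line (x + t • v) ((1/2 - t) • v) 0 h r
  have hct : ∀ r t, HasDerivAt (fun τ => c r τ) (w r) t := fun r t => by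
    have := hasDerivAt_emb_line (x + r • ((1/2:ℝ) • v)) ((1 - r) • v) (r * h) 0 t
    convert this using 1
    funext τ
    simp only [c, mul_zero, add_zero]
    congr 1
    module
  have he : ∀ t, HasDerivAt e (-emb v 0) t := fun t => by
    have := hasDerivAt_emb_line ((1/2:ℝ) • v) (-v) h 0 t
    convert this using 1
    · funext τ
      simp only [e, mul_zero, add_zero]
      congr 1
      module
    · simpa using (emb_smul (-1) v 0).symm
  have hw : ∀ r, HasDerivAt w (-emb v 0) r := fun r => by
    have := hasDerivAt_emb_line v (-v) 0 0 r
    convert this using 1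
    · funext τ
      simp only [w, mul_zero, add_zero]
      congr 1
      module
    · simpa using (emb_smul (-1) v 0).symm
  have hen : ∀ t ∈ Icc (0:ℝ) 1, ‖e t‖ ≤ 3/2 * h := fun t ht => by
    refine (norm_emb_le _ _).trans ?_
    rw [norm_smul, ← hh, abs_of_nonneg hh0, Real.norm_eq_abs]
    have : |1/2 - t| ≤ 1/2 := abs_le.2 ⟨by linarith [ht.2], by linarith [ht.1]⟩
    nlinarith
  have hwn : ∀ r ∈ Icc (0:ℝ) 1, ‖w r‖ ≤ h := fun r hr => by
    refine (norm_emb_le _ _).trans ?_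
    rw [norm_smul, ← hh, abs_zero, add_zero, Real.norm_eq_abs]
    have : |1 - r| ≤ 1 := abs_le.2 ⟨by linarith [hr.2], by linarith [hr.1]⟩
    nlinarith
  have hΓr : ∀ r ∈ Icc (0:ℝ) 1, ∀ t, HasDerivWithinAt (fun ρ => Γ (c ρ t)) (DΓ (c r t) (e t))
      (Icc 0 1) r := fun r hr t =>
    chain_G Γ (DΓ (c r t)) _ (fun ρ => c ρ t) (e t) _ r (hdΓ _ (hcm r hr t)) (hcr r t)
      (fun r' hr' => hcm r' hr' t)
  have hΓt : ∀ r ∈ Icc (0:ℝ) 1, ∀ t, HasDerivWithinAt (fun τ => Γ (c r τ)) (DΓ (c r t) (w r))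
      (Icc 0 1) t := fun r hr t =>
    chain_G Γ (DΓ (c r t)) _ (fun τ => c r τ) (w r) _ t (hdΓ _ (hcm r hr t)) (hct r t)
      (fun t' _ => hcm r hr t')
  have hcc : Continuous (fun q : ℝ × ℝ => c q.1 q.2) := by
    simp only [c]
    exact continuous_emb.comp (g := fun q : EuclideanSpace ℝ (Fin n) × ℝ => emb q.1 q.2)
      (f := fun q : ℝ × ℝ => ((x + q.2 • v) + q.1 • ((1/2 - q.2) • v), q.1 * h)) (by fun_prop)
  have hec : Continuous e := continuous_iff_continuousAt.2 fun t => (he t).continuousAt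
  have hwc : Continuous w := continuous_iff_continuousAt.2 fun t => (hw t).continuousAt
  have hmaps : MapsTo (fun q : ℝ × ℝ => c q.1 q.2) (Icc 0 1 ×ˢ Icc 0 1) (closedHalfSpace n) :=
    fun q hq => hcm q.1 hq.1 q.2
  have hΓc : ContinuousOn (fun q : ℝ × ℝ => Γ (c q.1 q.2)) (Icc 0 1 ×ˢ Icc 0 1) :=
    hΓ.comp hcc.continuousOn hmaps
  have hDΓc : ContinuousOn (fun q : ℝ × ℝ => DΓ (c q.1 q.2)) (Icc 0 1 ×ˢ Icc 0 1) :=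
    hDΓ.comp hcc.continuousOn hmaps
  -- the family of transports
  have hex : ∀ t ∈ Icc (0:ℝ) 1, ∃ u : ℝ → F, u 0 = P t (U (emb (x + v) 0)) ∧
      ∀ r ∈ Icc (0:ℝ) 1, HasDerivWithinAt u (-(Γ (c r t) (e t) (u r))) (Icc 0 1) r := by
    intro t ht
    apply skew_ode_exists (fun r => Γ (c r t) (e t))
    · have h1 : ContinuousOn (fun r : ℝ => Γ (c r t)) (Icc 0 1) :=
        hΓc.comp (f := fun r : ℝ => (r, t)) (by fun_prop) (fun r hr => ⟨hr, ht⟩)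
      exact h1.clm_apply continuousOn_const
    · exact fun r hr => hsk _ (hcm r hr t) _
  choose! u hu0 hu using hex
  have hφ : ∀ t ∈ Icc (0:ℝ) 1, HasDerivWithinAt (fun t => P t (U (emb (x + v) 0)))
      (-(Γ (c 0 t) (w 0) (P t (U (emb (x + v) 0))))) (Icc 0 1) t := by
    intro t ht
    have := (hP t ht).clm_apply (hasDerivWithinAt_const t (Icc 0 1) (U (emb (x + v) 0)))
    simpa [c, w] using this
  have hol := holonomy_bound (fun r t => Γ (c r t) (w r)) (fun r t => Γ (c r t) (e t))
    (fun r t => DΓ (c r t) (e t) (w r) + Γ (c r t) (-emb v 0))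
    (fun r t => DΓ (c r t) (w r) (e t) + Γ (c r t) (-emb v 0))
    (fun t => P t (U (emb (x + v) 0))) u (3/2 * β * h ^ 2)
    (fun t ht => hsk _ (hcm 0 z0 t) _)
    (fun r hr t ht => hsk _ (hcm r hr t) _)
    (fun r hr t ht => (hΓr r hr t).clm_apply (hw r).hasDerivWithinAt)
    (fun r hr t ht => (hΓt r hr t).clm_apply (he t).hasDerivWithinAt)
    (by
      apply ContinuousOn.add
      · exact (hDΓc.clm_apply (hwc.comp continuous_fst).continuousOn).clm_apply
          (hec.comp continuous_snd).continuousOn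
      · exact hΓc.clm_apply continuousOn_const)
    (by
      intro r hr t ht
      have h1 := hK _ (hcm r hr t) (w r) (e t)
      rw [add_sub_add_right_eq_sub]
      refine h1.trans ?_
      have h2 := mul_le_mul (hwn r hr) (hen t ht) (norm_nonneg _) hh0
      calc β * ‖w r‖ * ‖e t‖ = β * (‖w r‖ * ‖e t‖) := by ring
        _ ≤ β * (h * (3/2 * h)) := mul_le_mul_of_nonneg_left h2 hβ
        _ = _ := by ring)
    (by
      intro t ht
      have : w 1 = 0 := by
        simpa [w] using emb_smul 0 v 0
      simp [this])
    hφ hu0 hu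
  have hn1 : ‖P 0 (U (emb (x + v) 0))‖ = ‖U (emb (x + v) 0)‖ := by
    have := skew_norm _ _ (fun t => Γ (c 0 t) (w 0)) (fun _ => 0) continuous_const hφ
      (fun t ht => hsk _ (hcm 0 z0 t) _) (by simp) 1 z1
    simp [hP1] at this
    linarith
  have hz0 : ∀ r : ℝ, (0:ℝ) • r = 0 := by simp
  have hUc : ContinuousOn U (closedHalfSpace n) := fun z hz => (hU z hz).continuousWithinAt
  have hg := continuous_gDens Γ U DU hΓ hUc hDU
  have hgn : ∀ q, 0 ≤ gDens Γ U DU q := fun q => Real.sqrt_nonneg _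
  have hbd : ∀ (x0 w0 : EuclideanSpace ℝ (Fin n)), ‖emb w0 h‖ ≤ 3/2 * h →
      ∫ r in (0:ℝ)..1, gDens Γ U DU (x0 + r • w0, r * h) * ‖emb w0 h‖ ≤
      3/2 * (h * ∫ r in (0:ℝ)..1, gDens Γ U DU (x0 + r • w0, r * h)) := by
    intro x0 w0 hw0
    rw [intervalIntegral.integral_mul_const]
    have : 0 ≤ ∫ r in (0:ℝ)..1, gDens Γ U DU (x0 + r • w0, r * h) :=
      intervalIntegral.integral_nonneg zero_le_one (fun r _ => hgn _)
    nlinarith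
  have ex0 : ‖emb ((1/2:ℝ) • v) h‖ ≤ 3/2 * h := by simpa [e] using hen 0 z0
  have ey0 : ‖emb ((-1/2:ℝ) • v) h‖ ≤ 3/2 * h := by
    have := hen 1 z1
    norm_num [e] at this ⊢
    exact this
  have hz : x + v + (-1/2:ℝ) • v = x + (1/2:ℝ) • v := by module
  have sx := seg_bound Γ U DU hΓ hsk hU hDU x ((1/2:ℝ) • v) h hh0 (u 0) (by
    intro r hr; simpa [c, e] using hu 0 z0 r hr)
  have sx' := seg_bound Γ U DU hΓ hsk hU hDU x ((1/2:ℝ) • v) h hh0 (fun _ => 0) (by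
    intro r hr; simpa using hasDerivWithinAt_const r (Icc (0:ℝ) 1) (0:F))
  have hh1 : (1/2 - 1 : ℝ) = -1/2 := by norm_num
  have sy := seg_bound Γ U DU hΓ hsk hU hDU (x + v) ((-1/2:ℝ) • v) h hh0 (u 1) (by
    intro r hr
    have := hu 1 z1 r hr
    simp only [c, e, hh1, one_smul] at this
    exact this)
  have sy' := seg_bound Γ U DU hΓ hsk hU hDU (x + v) ((-1/2:ℝ) • v) h hh0 (fun _ => 0) (by
    intro r hr; simpa using hasDerivWithinAt_const r (Icc (0:ℝ) 1) (0:F))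
  rw [hz] at sy sy'
  rw [hu0 0 z0] at sx
  rw [hu0 1 z1, hP1] at sy
  simp only [sub_zero, ContinuousLinearMap.id_apply, sub_self, norm_zero] at sx sx' sy sy'
  have bx := hbd x ((1/2:ℝ) • v) ex0
  have bY := hbd (x + v) ((-1/2:ℝ) • v) ey0
  simp only [hn1] at hol
  set Ix := h * ∫ r in (0:ℝ)..1, gDens Γ U DU (x + r • ((1/2:ℝ) • v), r * h) with hIx
  set Iy := h * ∫ r in (0:ℝ)..1, gDens Γ U DU (x + v + r • ((-1/2:ℝ) • v), r * h) with hIy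
  set a := ‖U (emb (x + (1/2:ℝ) • v) h)‖ with ha
  have hIx0 : 0 ≤ Ix := mul_nonneg hh0 (intervalIntegral.integral_nonneg zero_le_one fun r _ => hgn _)
  have hIy0 : 0 ≤ Iy := mul_nonneg hh0 (intervalIntegral.integral_nonneg zero_le_one fun r _ => hgn _)
  have ha0 : 0 ≤ a := norm_nonneg _
  have q1 := (abs_le.1 sx).1
  have q2 := (abs_le.1 sx').1
  have q3 := (abs_le.1 sy).2
  have q4 := (abs_le.1 sy').1
  set b := √β * h with hb
  have hb0 : 0 ≤ b := by positivity
  have hb2 : β * h ^ 2 = b ^ 2 := by rw [hb, mul_pow, Real.sq_sqrt hβ]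
  rcases le_total b 1 with hb1 | hb1
  · have q5 : ‖U (emb (x + (1/2:ℝ) • v) h) - u 0 1‖ ≤
        ‖U (emb (x + (1/2:ℝ) • v) h) - u 1 1‖ + ‖u 1 1 - u 0 1‖ := by
      simpa using norm_add_le (U (emb (x + (1/2:ℝ) • v) h) - u 1 1) (u 1 1 - u 0 1)
    have q6 : 3/2 * β * h ^ 2 * ‖U (emb (x + v) 0)‖ ≤ 3/2 * b * (a + 3/2 * Iy) := by
      have t1 : 3/2 * β * h ^ 2 ≤ 3/2 * b := by
        rw [mul_assoc, hb2]; nlinarith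
      exact mul_le_mul t1 (by linarith) (norm_nonneg _) (by positivity)
    have q7 : b * Iy ≤ Iy := by nlinarith
    have q8 : 0 ≤ b * a := mul_nonneg hb0 ha0
    linarith
  · have q5 := norm_sub_le (U (emb x 0)) (P 0 (U (emb (x + v) 0)))
    rw [hn1] at q5
    have q8 : a ≤ b * a := by nlinarith
    linarith

end Geo


section Ana

theorem lintegral_polar (n : ℕ) (hn : 1 ≤ n) (f : ℝ → ℝ≥0∞) (hf : Measurable f) :
    ∫⁻ x : EuclideanSpace ℝ (Fin n), f ‖x‖ =
      (volume : Measure (EuclideanSpace ℝ (Fin n))).toSphere univ *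
        ∫⁻ y in Ioi (0:ℝ), ENNReal.ofReal (y ^ (n - 1)) * f y := by
  have : Nonempty (Fin n) := ⟨⟨0, hn⟩⟩
  set μ := (volume : Measure (EuclideanSpace ℝ (Fin n))) with hμ
  have hd : Module.finrank ℝ (EuclideanSpace ℝ (Fin n)) = n := by simp
  calc
    ∫⁻ x : EuclideanSpace ℝ (Fin n), f ‖x‖
      = ∫⁻ x : ({(0)}ᶜ : Set (EuclideanSpace ℝ (Fin n))), f (‖x.1‖) ∂(μ.comap (↑)) := by
      rw [lintegral_subtype_comap (measurableSet_singleton _).compl fun x ↦ f (‖x‖),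
        restrict_compl_singleton]
    _ = ∫⁻ x, f x.2 ∂μ.toSphere.prod
          (.volumeIoiPow (Module.finrank ℝ (EuclideanSpace ℝ (Fin n)) - 1)) := by
      simpa using μ.measurePreserving_homeomorphUnitSphereProd.lintegral_comp_emb
        (Homeomorph.measurableEmbedding _) (f ∘ Subtype.val ∘ Prod.snd)
    _ = μ.toSphere univ * ∫⁻ x : Ioi (0 : ℝ), f x ∂.volumeIoiPow (n - 1) := by
      rw [hd, lintegral_prod _ (by fun_prop)]
      simp [mul_comm]
    _ = _ := by
      congr 1
      simp only [Measure.volumeIoiPow]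
      rw [lintegral_withDensity_eq_lintegral_mul _ (by fun_prop) (by fun_prop)]
      simp only [Pi.mul_apply]
      rw [lintegral_subtype_comap measurableSet_Ioi
        (fun x : ℝ => ENNReal.ofReal (x ^ (n - 1)) * f x)]

theorem lintegral_polar_rpow (n : ℕ) (hn : 1 ≤ n) (a : ℝ) (f : ℝ → ℝ≥0∞) (hf : Measurable f) :
    ∫⁻ x : EuclideanSpace ℝ (Fin n), ENNReal.ofReal (‖x‖ ^ (a + 1 - n)) * f ‖x‖ =
      (volume : Measure (EuclideanSpace ℝ (Fin n))).toSphere univ *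
        ∫⁻ y in Ioi (0:ℝ), ENNReal.ofReal (y ^ a) * f y := by
  rw [lintegral_polar n hn (fun t => ENNReal.ofReal (t ^ (a + 1 - n)) * f t) (by fun_prop)]
  congr 1
  refine setLIntegral_congr_fun measurableSet_Ioi fun y hy => ?_
  have hy : 0 < y := hy

  rw [← mul_assoc, ← ENNReal.ofReal_mul (by positivity), ← Real.rpow_natCast,
    ← Real.rpow_add hy]
  congr 3
  push_cast [Nat.cast_sub hn]; ring

theorem lintegral_scale (a r : ℝ) (hr : 0 < r) (H : ℝ → ℝ≥0∞) (hH : Measurable H) :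
    ∫⁻ t in Ioi (0:ℝ), ENNReal.ofReal (t ^ a) * H (r * t) =
      ENNReal.ofReal (r ^ (-(a+1))) * ∫⁻ t in Ioi (0:ℝ), ENNReal.ofReal (t ^ a) * H t := by
  set φ : ℝ → ℝ≥0∞ := (Ioi (0:ℝ)).indicator
    (fun t => ENNReal.ofReal ((r⁻¹ * t) ^ a) * H t) with hφ
  have hφm : Measurable φ := by
    apply Measurable.indicator _ measurableSet_Ioi
    fun_prop
  have h1 : ∫⁻ t, φ (r * t) = ENNReal.ofReal |r⁻¹| * ∫⁻ t, φ t := by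
    rw [← lintegral_map (f := φ) hφm (by fun_prop), Real.map_volume_mul_left hr.ne',
      lintegral_smul_measure, smul_eq_mul]
  have h2 : ∫⁻ t, φ (r * t) = ∫⁻ t in Ioi (0:ℝ), ENNReal.ofReal (t ^ a) * H (r * t) := by
    rw [← lintegral_indicator measurableSet_Ioi]
    congr 1; ext t
    simp only [hφ, indicator, mem_Ioi, mul_pos_iff_of_pos_left hr, inv_mul_cancel_left₀ hr.ne']
  rw [← h2, h1, hφ, lintegral_indicator measurableSet_Ioi,
    ← lintegral_const_mul _ (by fun_prop), ← lintegral_const_mul _ (by fun_prop)]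
  refine setLIntegral_congr_fun measurableSet_Ioi fun y hy => ?_
  have hy : 0 < y := hy

  rw [← mul_assoc, ← mul_assoc, ← ENNReal.ofReal_mul (by positivity),
    ← ENNReal.ofReal_mul (by positivity), Real.mul_rpow (by positivity) hy.le, ← mul_assoc]
  congr 3
  rw [abs_of_pos (by positivity), Real.inv_rpow hr.le, ← Real.rpow_neg hr.le, neg_add,
    Real.rpow_add hr, Real.rpow_neg_one, mul_comm]

theorem lintegral_rpow_unit (s : ℝ) (hs : 0 < s) :
    ∫⁻ r in Ioc (0:ℝ) 1, ENNReal.ofReal (r ^ (s - 1)) = ENNReal.ofReal (1 / s) := by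
  have hi : IntervalIntegrable (fun r : ℝ => r ^ (s - 1)) volume 0 1 :=
    intervalIntegral.intervalIntegrable_rpow' (by linarith)
  rw [← ofReal_integral_eq_lintegral_ofReal]
  · rw [← intervalIntegral.integral_of_le zero_le_one, integral_rpow (Or.inl (by linarith))]
    simp [Real.zero_rpow hs.ne']
  · rwa [intervalIntegrable_iff_integrableOn_Ioc_of_le zero_le_one] at hi
  · filter_upwards [ae_restrict_mem measurableSet_Ioc] with r hr
    exact Real.rpow_nonneg hr.1.le _

theorem jensen_unit (s p : ℝ) (hs : 0 < s) (hp : 1 ≤ p) (f : ℝ → ℝ≥0∞) (hf : Measurable f) :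
    (∫⁻ r in Ioc (0:ℝ) 1, f r) ^ p ≤ ENNReal.ofReal (1 / s) ^ (p - 1) *
      ∫⁻ r in Ioc (0:ℝ) 1, ENNReal.ofReal (r ^ ((1 - s) * (p - 1))) * f r ^ p := by
  rcases eq_or_lt_of_le hp with rfl | hp1
  · simp
  set q := p / (p - 1) with hq
  have hpq : p.HolderConjugate q := Real.HolderConjugate.conjExponent hp1
  have hq0 : 0 < q := hpq.symm.pos
  have hp0 : 0 < p := hpq.pos
  set c := (1 - s) / q with hc
  have h := ENNReal.lintegral_mul_le_Lp_mul_Lq (volume.restrict (Ioc (0:ℝ) 1)) hpq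
    (f := fun r => ENNReal.ofReal (r ^ c) * f r) (g := fun r => ENNReal.ofReal (r ^ (-c)))
    (by fun_prop) (by fun_prop)
  have e1 : ∫⁻ r in Ioc (0:ℝ) 1, ((fun r => ENNReal.ofReal (r ^ c) * f r) *
      (fun r => ENNReal.ofReal (r ^ (-c)))) r = ∫⁻ r in Ioc (0:ℝ) 1, f r := by
    refine setLIntegral_congr_fun measurableSet_Ioc fun r hr => ?_
    simp only [Pi.mul_apply]
    rw [mul_right_comm, ← ENNReal.ofReal_mul (Real.rpow_nonneg hr.1.le _), ← Real.rpow_add hr.1]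
    simp
  have e2 : ∫⁻ r in Ioc (0:ℝ) 1, (ENNReal.ofReal (r ^ (-c))) ^ q = ENNReal.ofReal (1 / s) := by
    rw [← lintegral_rpow_unit s hs]
    refine setLIntegral_congr_fun measurableSet_Ioc fun r hr => ?_

    rw [ENNReal.ofReal_rpow_of_nonneg (Real.rpow_nonneg hr.1.le _) hq0.le, ← Real.rpow_mul hr.1.le]
    congr 2
    rw [hc]; field_simp; ring
  have e3 : ∫⁻ r in Ioc (0:ℝ) 1, (ENNReal.ofReal (r ^ c) * f r) ^ p =
      ∫⁻ r in Ioc (0:ℝ) 1, ENNReal.ofReal (r ^ ((1 - s) * (p - 1))) * f r ^ p := by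
    refine setLIntegral_congr_fun measurableSet_Ioc fun r hr => ?_

    rw [ENNReal.mul_rpow_of_nonneg _ _ hp0.le,
      ENNReal.ofReal_rpow_of_nonneg (Real.rpow_nonneg hr.1.le _) hp0.le, ← Real.rpow_mul hr.1.le]
    congr 3
    have : p - 1 ≠ 0 := by linarith
    rw [hc, hq]; field_simp

  rw [e1, e2, e3] at h
  calc _ ≤ _ := ENNReal.rpow_le_rpow h hp0.le
    _ = _ := by
      rw [ENNReal.mul_rpow_of_nonneg _ _ hp0.le, ← ENNReal.rpow_mul, ← ENNReal.rpow_mul, mul_comm]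
      have h1 : 1 / p * p = 1 := by field_simp
      have h2 : 1 / q * p = p - 1 := by
        have : p - 1 ≠ 0 := by linarith
        rw [hq]; field_simp
      rw [h1, h2, ENNReal.rpow_one]

end Ana


section Ana2

theorem term_two {n : ℕ} (hn : 1 ≤ n) (a : ℝ)
    (Ψ : EuclideanSpace ℝ (Fin n) × ℝ → ℝ≥0∞) (hΨ : Measurable Ψ)
    (w : EuclideanSpace ℝ (Fin n) → EuclideanSpace ℝ (Fin n)) (hw : Measurable w) :
    ∫⁻ x : EuclideanSpace ℝ (Fin n), ∫⁻ v : EuclideanSpace ℝ (Fin n),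
      ENNReal.ofReal (‖v‖ ^ (a + 1 - n)) * Ψ (x + w v, ‖v‖) =
    (volume : Measure (EuclideanSpace ℝ (Fin n))).toSphere univ *
      ∫⁻ x : EuclideanSpace ℝ (Fin n), ∫⁻ t in Ioi (0:ℝ), ENNReal.ofReal (t ^ a) * Ψ (x, t) := by
  have hH : Measurable (fun t => ∫⁻ x, Ψ (x, t)) := by
    apply Measurable.lintegral_prod_left'
    exact hΨ
  rw [lintegral_lintegral_swap (by apply Measurable.aemeasurable; fun_prop)]
  have e1 : ∀ v : EuclideanSpace ℝ (Fin n), ∫⁻ x : EuclideanSpace ℝ (Fin n),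
      ENNReal.ofReal (‖v‖ ^ (a + 1 - n)) * Ψ (x + w v, ‖v‖) =
      ENNReal.ofReal (‖v‖ ^ (a + 1 - n)) * (fun t => ∫⁻ x, Ψ (x, t)) ‖v‖ := by
    intro v
    rw [lintegral_const_mul _ (by fun_prop),
      lintegral_add_right_eq_self (fun x => Ψ (x, ‖v‖)) (w v)]
  simp_rw [e1]
  rw [lintegral_polar_rpow n hn a (fun t => ∫⁻ x, Ψ (x, t)) hH]
  congr 1
  rw [lintegral_lintegral_swap (by apply Measurable.aemeasurable; fun_prop)]
  congr 1; ext t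
  rw [lintegral_const_mul _ (by fun_prop)]

theorem term_one {n : ℕ} (hn : 1 ≤ n) (a s p : ℝ) (hs : 0 < s) (ha : a + 1 = (1 - s) * p)
    (Φ : EuclideanSpace ℝ (Fin n) × ℝ → ℝ≥0∞) (hΦ : Measurable Φ)
    (w : ℝ × EuclideanSpace ℝ (Fin n) → EuclideanSpace ℝ (Fin n)) (hw : Measurable w) :
    ∫⁻ x : EuclideanSpace ℝ (Fin n), ∫⁻ v : EuclideanSpace ℝ (Fin n),
      ENNReal.ofReal (‖v‖ ^ (a + 1 - n)) *
      ∫⁻ r in Ioc (0:ℝ) 1, ENNReal.ofReal (r ^ ((1 - s) * (p - 1))) *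
        Φ (x + w (r, v), r * ‖v‖) =
    (volume : Measure (EuclideanSpace ℝ (Fin n))).toSphere univ * ENNReal.ofReal (1 / s) *
      ∫⁻ x : EuclideanSpace ℝ (Fin n), ∫⁻ t in Ioi (0:ℝ), ENNReal.ofReal (t ^ a) * Φ (x, t) := by
  have hm : Measurable (fun q : EuclideanSpace ℝ (Fin n) × EuclideanSpace ℝ (Fin n) × ℝ =>
      ENNReal.ofReal (‖q.2.1‖ ^ (a + 1 - n)) * (ENNReal.ofReal (q.2.2 ^ ((1 - s) * (p - 1))) *
        Φ (q.1 + w (q.2.2, q.2.1), q.2.2 * ‖q.2.1‖))) := by fun_prop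
  set I := ∫⁻ x : EuclideanSpace ℝ (Fin n), ∫⁻ t in Ioi (0:ℝ), ENNReal.ofReal (t ^ a) * Φ (x, t)
  set σ := (volume : Measure (EuclideanSpace ℝ (Fin n))).toSphere univ
  have e1 : ∀ x v : EuclideanSpace ℝ (Fin n), ENNReal.ofReal (‖v‖ ^ (a + 1 - n)) *
      ∫⁻ r in Ioc (0:ℝ) 1, ENNReal.ofReal (r ^ ((1 - s) * (p - 1))) *
        Φ (x + w (r, v), r * ‖v‖) = ∫⁻ r in Ioc (0:ℝ) 1, ENNReal.ofReal (‖v‖ ^ (a + 1 - n)) *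
        (ENNReal.ofReal (r ^ ((1 - s) * (p - 1))) * Φ (x + w (r, v), r * ‖v‖)) := by
    intro x v
    rw [lintegral_const_mul _ (by fun_prop)]
  simp_rw [e1]
  have e2 : ∀ x : EuclideanSpace ℝ (Fin n), ∫⁻ v : EuclideanSpace ℝ (Fin n),
      ∫⁻ r in Ioc (0:ℝ) 1, ENNReal.ofReal (‖v‖ ^ (a + 1 - n)) *
        (ENNReal.ofReal (r ^ ((1 - s) * (p - 1))) * Φ (x + w (r, v), r * ‖v‖)) =
      ∫⁻ r in Ioc (0:ℝ) 1, ∫⁻ v : EuclideanSpace ℝ (Fin n), ENNReal.ofReal (‖v‖ ^ (a + 1 - n)) *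
        (ENNReal.ofReal (r ^ ((1 - s) * (p - 1))) * Φ (x + w (r, v), r * ‖v‖)) := by
    intro x
    rw [lintegral_lintegral_swap (by apply Measurable.aemeasurable; fun_prop)]
  simp_rw [e2]
  rw [lintegral_lintegral_swap (by
    apply Measurable.aemeasurable
    apply Measurable.lintegral_prod_right' (f := fun q : (EuclideanSpace ℝ (Fin n) × ℝ) ×
      EuclideanSpace ℝ (Fin n) => ENNReal.ofReal (‖q.2‖ ^ (a + 1 - n)) *
        (ENNReal.ofReal (q.1.2 ^ ((1 - s) * (p - 1))) *
          Φ (q.1.1 + w (q.1.2, q.2), q.1.2 * ‖q.2‖)))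
    fun_prop)]
  have e3 : ∀ r ∈ Ioc (0:ℝ) 1, ∫⁻ x : EuclideanSpace ℝ (Fin n), ∫⁻ v : EuclideanSpace ℝ (Fin n),
      ENNReal.ofReal (‖v‖ ^ (a + 1 - n)) *
        (ENNReal.ofReal (r ^ ((1 - s) * (p - 1))) * Φ (x + w (r, v), r * ‖v‖)) =
      ENNReal.ofReal (r ^ (s - 1)) * (σ * I) := by
    intro r hr
    have h := term_two hn a (fun q => ENNReal.ofReal (r ^ ((1 - s) * (p - 1))) * Φ (q.1, r * q.2))
      (by fun_prop) (fun v => w (r, v)) (by fun_prop)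
    simp only at h
    rw [h, mul_left_comm]
    congr 1
    have h2 : ∀ x : EuclideanSpace ℝ (Fin n), ∫⁻ t in Ioi (0:ℝ), ENNReal.ofReal (t ^ a) *
        (ENNReal.ofReal (r ^ ((1 - s) * (p - 1))) * Φ (x, r * t)) =
        ENNReal.ofReal (r ^ (s - 1)) * ∫⁻ t in Ioi (0:ℝ), ENNReal.ofReal (t ^ a) * Φ (x, t) := by
      intro x
      simp_rw [mul_left_comm (ENNReal.ofReal (_ ^ a))]
      rw [lintegral_const_mul _ (by fun_prop),
        lintegral_scale a r hr.1 (fun t => Φ (x, t)) (by fun_prop), ← mul_assoc,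
        ← ENNReal.ofReal_mul (Real.rpow_nonneg hr.1.le _), ← Real.rpow_add hr.1, ha]
      congr 3
      ring_nf
    simp_rw [h2]
    rw [lintegral_const_mul]
    apply Measurable.lintegral_prod_right' (f := fun q : EuclideanSpace ℝ (Fin n) × ℝ =>
      ENNReal.ofReal (q.2 ^ a) * Φ (q.1, q.2))
    fun_prop
  rw [setLIntegral_congr_fun measurableSet_Ioc e3, lintegral_mul_const _ (by fun_prop),
    lintegral_rpow_unit s hs]
  ring

end Ana2


section Ana3

theorem one_le_rpow_aux (x : ℝ≥0∞) (q : ℝ) (hx : 1 ≤ x) (hq : 0 ≤ q) : 1 ≤ x ^ q := by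
  simpa using ENNReal.rpow_le_rpow hx hq

theorem ofReal_interval (f : ℝ → ℝ) (hf : Continuous f) (hf0 : ∀ r, 0 ≤ f r) :
    ENNReal.ofReal (∫ r in (0:ℝ)..1, f r) = ∫⁻ r in Ioc (0:ℝ) 1, ENNReal.ofReal (f r) := by
  rw [intervalIntegral.integral_of_le zero_le_one, ofReal_integral_eq_lintegral_ofReal]
  · exact (hf.intervalIntegrable 0 1).1
  · exact Eventually.of_forall hf0

theorem pw_ennreal (n : ℕ) (s p : ℝ) (hs0 : 0 < s) (hs1 : s < 1) (hp : 1 ≤ p)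
    (N L b d : ℝ) (hN0 : 0 ≤ N) (hL : 0 < L) (hb : 0 ≤ b) (hd : 0 ≤ d) (f g : ℝ → ℝ)
    (hf : Continuous f) (hg : Continuous g) (hf0 : ∀ r, 0 ≤ f r) (hg0 : ∀ r, 0 ≤ g r)
    (hN : N ≤ 6 * (L * (∫ r in (0:ℝ)..1, f r) + L * (∫ r in (0:ℝ)..1, g r) + b * L * d)) :
    ENNReal.ofReal (N ^ p / L ^ ((n : ℝ) + s * p)) ≤
      ((6:ℝ≥0∞) ^ p * (2 ^ (p - 1) * 2 ^ (p - 1) * ENNReal.ofReal (1 / s) ^ (p - 1))) *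
      (ENNReal.ofReal (L ^ (((1 - s) * p - 1) + 1 - n)) *
          (∫⁻ r in Ioc (0:ℝ) 1, ENNReal.ofReal (r ^ ((1 - s) * (p - 1))) * ENNReal.ofReal (f r) ^ p)
        + ENNReal.ofReal (L ^ (((1 - s) * p - 1) + 1 - n)) *
          (∫⁻ r in Ioc (0:ℝ) 1, ENNReal.ofReal (r ^ ((1 - s) * (p - 1))) * ENNReal.ofReal (g r) ^ p)
        + ENNReal.ofReal (L ^ (((1 - s) * p - 1) + 1 - n)) * ENNReal.ofReal (b ^ p * d ^ p)) := by
  have hp0 : 0 < p := by linarith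
  set A := ∫⁻ r in Ioc (0:ℝ) 1, ENNReal.ofReal (f r) with hA
  set B := ∫⁻ r in Ioc (0:ℝ) 1, ENNReal.ofReal (g r) with hB
  set D := ENNReal.ofReal (b * d) with hD
  set A' := ∫⁻ r in Ioc (0:ℝ) 1, ENNReal.ofReal (r ^ ((1 - s) * (p - 1))) * ENNReal.ofReal (f r) ^ p
  set B' := ∫⁻ r in Ioc (0:ℝ) 1, ENNReal.ofReal (r ^ ((1 - s) * (p - 1))) * ENNReal.ofReal (g r) ^ p
  set M := ENNReal.ofReal (1 / s) ^ (p - 1) with hM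
  have hM1 : 1 ≤ M := by
    apply one_le_rpow_aux _ _ _ (by linarith)
    rw [ENNReal.one_le_ofReal, le_div_iff₀ hs0]; linarith
  have h21 : (1:ℝ≥0∞) ≤ 2 ^ (p - 1) := one_le_rpow_aux _ _ (by norm_num) (by linarith)
  have hAp : A ^ p ≤ M * A' := jensen_unit s p hs0 hp _ (by fun_prop)
  have hBp : B ^ p ≤ M * B' := jensen_unit s p hs0 hp _ (by fun_prop)
  have hDp : D ^ p = ENNReal.ofReal (b ^ p * d ^ p) := by
    rw [hD, ENNReal.ofReal_rpow_of_nonneg (by positivity) hp0.le, Real.mul_rpow hb hd]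
  have hfi : 0 ≤ ∫ r in (0:ℝ)..1, f r :=
    intervalIntegral.integral_nonneg zero_le_one fun r _ => hf0 r
  have hgi : 0 ≤ ∫ r in (0:ℝ)..1, g r :=
    intervalIntegral.integral_nonneg zero_le_one fun r _ => hg0 r
  have hNE : ENNReal.ofReal N ≤ 6 * (ENNReal.ofReal L * (A + B + D)) := by
    rw [hA, hB, hD, ← ofReal_interval f hf hf0, ← ofReal_interval g hg hg0,
      ← ENNReal.ofReal_add hfi hgi, ← ENNReal.ofReal_add (by positivity) (by positivity),
      ← ENNReal.ofReal_mul hL.le]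
    have : (6:ℝ≥0∞) = ENNReal.ofReal 6 := by simp
    rw [this, ← ENNReal.ofReal_mul (by norm_num)]
    apply ENNReal.ofReal_le_ofReal
    refine hN.trans (le_of_eq ?_)
    ring
  have hsum : (A + B + D) ^ p ≤ (2 ^ (p - 1) * 2 ^ (p - 1) * M) * (A' + B' + D ^ p) := by
    calc (A + B + D) ^ p ≤ 2 ^ (p - 1) * ((A + B) ^ p + D ^ p) :=
          ENNReal.rpow_add_le_mul_rpow_add_rpow _ _ hp
      _ ≤ 2 ^ (p - 1) * (2 ^ (p - 1) * (A ^ p + B ^ p) + 2 ^ (p - 1) * D ^ p) := by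
          gcongr
          · exact ENNReal.rpow_add_le_mul_rpow_add_rpow _ _ hp
          · exact le_mul_of_one_le_left' h21
      _ ≤ 2 ^ (p - 1) * (2 ^ (p - 1) * (M * A' + M * B') + 2 ^ (p - 1) * (M * D ^ p)) := by
          gcongr
          exact le_mul_of_one_le_left' hM1
      _ = _ := by ring
  have hdiv : N ^ p / L ^ ((n : ℝ) + s * p) = N ^ p * L ^ (-((n : ℝ) + s * p)) := by
    rw [Real.rpow_neg hL.le, div_eq_mul_inv]
  have hexp : ENNReal.ofReal L ^ p * ENNReal.ofReal (L ^ (-((n : ℝ) + s * p))) =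
      ENNReal.ofReal (L ^ (((1 - s) * p - 1) + 1 - n)) := by
    rw [ENNReal.ofReal_rpow_of_pos hL, ← ENNReal.ofReal_mul (by positivity), ← Real.rpow_add hL]
    congr 2; ring
  rw [hdiv, ENNReal.ofReal_mul (by positivity), ← ENNReal.ofReal_rpow_of_nonneg hN0 hp0.le, ← hDp]
  calc ENNReal.ofReal N ^ p * ENNReal.ofReal (L ^ (-((n : ℝ) + s * p)))
      ≤ (6 * (ENNReal.ofReal L * (A + B + D))) ^ p * ENNReal.ofReal (L ^ (-((n : ℝ) + s * p))) := by
        gcongr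
    _ = 6 ^ p * (ENNReal.ofReal L ^ p * ENNReal.ofReal (L ^ (-((n : ℝ) + s * p)))) *
          (A + B + D) ^ p := by
        rw [ENNReal.mul_rpow_of_nonneg _ _ hp0.le, ENNReal.mul_rpow_of_nonneg _ _ hp0.le]; ring
    _ ≤ 6 ^ p * ENNReal.ofReal (L ^ (((1 - s) * p - 1) + 1 - n)) *
          ((2 ^ (p - 1) * 2 ^ (p - 1) * M) * (A' + B' + D ^ p)) := by
        rw [hexp]; gcongr
    _ = _ := by ring

end Ana3


theorem lintegral_add3 {α : Type*} [MeasurableSpace α] {μ : Measure α} (f g h : α → ℝ≥0∞)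
    (hf : Measurable f) (hg : Measurable g) :
    ∫⁻ x, f x + g x + h x ∂μ = (∫⁻ x, f x ∂μ) + (∫⁻ x, g x ∂μ) + (∫⁻ x, h x ∂μ) := by
  have hfg : Measurable (fun x => f x + g x) := hf.add hg
  rw [lintegral_add_left hfg, lintegral_add_left hf]

end Helpers

/-- Gauge-covariant fractional trace estimate on the half-space:
the gauge-covariant Gagliardo seminorm of the trace `U(·,0)` is bounded by the weighted
energy of `D_Γ U` and `U`, with a constant depending only on `n`, `s`, `p`. -/
theorem trace_gagliardo_estimate
    {F : Type*} [NormedAddCommGroup F] [InnerProductSpace ℝ F] [FiniteDimensional ℝ F]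
    (n : ℕ) (hn : 1 ≤ n) (s p : ℝ) (hs0 : 0 < s) (hs1 : s < 1) (hp : 1 ≤ p) :
    ∃ C : ℝ, 0 < C ∧
      ∀ (Γ : EuclideanSpace ℝ (Fin (n + 1)) →
          EuclideanSpace ℝ (Fin (n + 1)) →L[ℝ] F →L[ℝ] F)
        (DΓ : EuclideanSpace ℝ (Fin (n + 1)) →
          EuclideanSpace ℝ (Fin (n + 1)) →L[ℝ] EuclideanSpace ℝ (Fin (n + 1)) →L[ℝ] F →L[ℝ] F),
        -- Γ of class C¹ on the closed half-space, with skew-adjoint values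
        (∀ z ∈ closedHalfSpace n, HasFDerivWithinAt Γ (DΓ z) (closedHalfSpace n) z) →
        ContinuousOn Γ (closedHalfSpace n) →
        ContinuousOn DΓ (closedHalfSpace n) →
        (∀ z ∈ closedHalfSpace n, ∀ (v : EuclideanSpace ℝ (Fin (n + 1))) (u w : F),
          ⟪(Γ z v) u, w⟫ = -⟪u, (Γ z v) w⟫) →
        -- β bounds the curvature K_Γ on the closed half-space
        ∀ β : ℝ,
        (∀ z ∈ closedHalfSpace n, ∀ v w : EuclideanSpace ℝ (Fin (n + 1)),
          ‖((DΓ z) v) w - ((DΓ z) w) v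
            + ((Γ z) v).comp ((Γ z) w) - ((Γ z) w).comp ((Γ z) v)‖ ≤ β * ‖v‖ * ‖w‖) →
        -- U of class C¹ with compact support on the closed half-space
        ∀ (U : EuclideanSpace ℝ (Fin (n + 1)) → F)
          (DU : EuclideanSpace ℝ (Fin (n + 1)) → EuclideanSpace ℝ (Fin (n + 1)) →L[ℝ] F),
        (∀ z ∈ closedHalfSpace n, HasFDerivWithinAt U (DU z) (closedHalfSpace n) z) →
        ContinuousOn DU (closedHalfSpace n) →
        HasCompactSupport U →
        -- Rt x y is the parallel transport R^{Γ∥}(x,y) along the boundary segment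
        ∀ Rt : EuclideanSpace ℝ (Fin n) → EuclideanSpace ℝ (Fin n) → F →L[ℝ] F,
        (∀ x y : EuclideanSpace ℝ (Fin n), ∃ P : ℝ → F →L[ℝ] F,
          P 1 = ContinuousLinearMap.id ℝ F ∧
          (∀ t ∈ Icc (0:ℝ) 1, HasDerivWithinAt P
            (-((Γ (emb ((1 - t) • x + t • y) 0)) (emb (y - x) 0)).comp (P t))
            (Icc (0:ℝ) 1) t) ∧
          Rt x y = P 0) →
        (∫⁻ x : EuclideanSpace ℝ (Fin n), ∫⁻ y : EuclideanSpace ℝ (Fin n),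
            ENNReal.ofReal (‖U (emb x 0) - (Rt x y) (U (emb y 0))‖ ^ p
              / ‖x - y‖ ^ ((n : ℝ) + s * p)))
          ≤ ENNReal.ofReal C *
            ∫⁻ x : EuclideanSpace ℝ (Fin n), ∫⁻ t in Ioi (0:ℝ),
              ENNReal.ofReal
                ((hsNorm (DU (emb x t) + (Γ (emb x t)).flip (U (emb x t))) ^ p
                  + β ^ (p / 2) * ‖U (emb x t)‖ ^ p) / t ^ (1 - (1 - s) * p)) := by
  set K : ℝ≥0∞ := (6:ℝ≥0∞) ^ p * (2 ^ (p - 1) * 2 ^ (p - 1) * ENNReal.ofReal (1 / s) ^ (p - 1))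
    with hKdef
  set σ := (volume : Measure (EuclideanSpace ℝ (Fin n))).toSphere univ with hσ
  set Ct : ℝ≥0∞ := K * (σ * ENNReal.ofReal (1 / s) + σ * ENNReal.ofReal (1 / s) + σ) + 1 with hCt
  have hp0 : 0 < p := by linarith
  have hp1 : 0 ≤ p - 1 := by linarith
  have hKt : K ≠ ∞ := by
    refine ENNReal.mul_ne_top (ENNReal.rpow_ne_top_of_nonneg hp0.le (by norm_num)) ?_
    refine ENNReal.mul_ne_top (ENNReal.mul_ne_top ?_ ?_) ?_
    · exact ENNReal.rpow_ne_top_of_nonneg hp1 (by norm_num)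
    · exact ENNReal.rpow_ne_top_of_nonneg hp1 (by norm_num)
    · exact ENNReal.rpow_ne_top_of_nonneg hp1 ENNReal.ofReal_ne_top
  have hσt : σ ≠ ∞ := measure_ne_top _ _
  have hCtt : Ct ≠ ∞ := by
    have : σ * ENNReal.ofReal (1 / s) ≠ ∞ := ENNReal.mul_ne_top hσt ENNReal.ofReal_ne_top
    exact ENNReal.add_ne_top.2 ⟨ENNReal.mul_ne_top hKt
      (ENNReal.add_ne_top.2 ⟨ENNReal.add_ne_top.2 ⟨this, this⟩, hσt⟩), ENNReal.one_ne_top⟩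
  have hCt0 : Ct ≠ 0 := by simp [hCt]
  refine ⟨Ct.toReal, ENNReal.toReal_pos hCt0 hCtt, ?_⟩
  intro Γ DΓ hdΓ hΓ hDΓ hskew β hcurv U DU hU hDU _ Rt hRt
  rw [ENNReal.ofReal_toReal hCtt]
  have hsk : ∀ z ∈ closedHalfSpace n, ∀ (v : EuclideanSpace ℝ (Fin (n + 1))) (w : F),
      ⟪(Γ z v) w, w⟫ = 0 := by
    intro z hz v w
    have h := hskew z hz v w w
    rw [real_inner_comm ((Γ z v) w) w] at h
    linarith
  have hβ : 0 ≤ β := by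
    have h := hcurv (emb 0 1) (emb_mem _ _ zero_le_one) (emb 0 1) (emb 0 1)
    have h1 : ‖(emb (0 : EuclideanSpace ℝ (Fin n)) 1)‖ = 1 := by
      have := norm_emb_sq (0 : EuclideanSpace ℝ (Fin n)) 1
      simp only [norm_zero] at this
      nlinarith [norm_nonneg (emb (0 : EuclideanSpace ℝ (Fin n)) 1)]
    rw [h1] at h
    have := (norm_nonneg _).trans h
    linarith
  have hUc : ContinuousOn U (closedHalfSpace n) := fun z hz => (hU z hz).continuousWithinAt
  have hg := continuous_gDens Γ U DU hΓ hUc hDU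
  have hgn : ∀ q, 0 ≤ gDens Γ U DU q := fun q => Real.sqrt_nonneg _
  have hd : Continuous (fun q : EuclideanSpace ℝ (Fin n) × ℝ => ‖U (emb q.1 |q.2|)‖) :=
    (continuous_comp_emb_abs hUc).norm
  set a := (1 - s) * p - 1 with ha
  set Φ : EuclideanSpace ℝ (Fin n) × ℝ → ℝ≥0∞ := fun q => ENNReal.ofReal (gDens Γ U DU q) ^ p
    with hΦ
  set Ψ : EuclideanSpace ℝ (Fin n) × ℝ → ℝ≥0∞ := fun q =>
    ENNReal.ofReal (√β ^ p * ‖U (emb q.1 |q.2|)‖ ^ p) with hΨ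
  have hgm : Measurable (gDens Γ U DU) := hg.measurable
  have hdm := hd.measurable
  have hΦm : Measurable Φ := by fun_prop
  have hΨm : Measurable Ψ := by fun_prop
  set T1 : EuclideanSpace ℝ (Fin n) → EuclideanSpace ℝ (Fin n) → ℝ≥0∞ := fun x v =>
    ENNReal.ofReal (‖v‖ ^ (a + 1 - n)) *
      ∫⁻ r in Ioc (0:ℝ) 1, ENNReal.ofReal (r ^ ((1 - s) * (p - 1))) *
        Φ (x + r • ((1/2:ℝ) • v), r * ‖v‖) with hT1
  set T2 : EuclideanSpace ℝ (Fin n) → EuclideanSpace ℝ (Fin n) → ℝ≥0∞ := fun x v =>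
    ENNReal.ofReal (‖v‖ ^ (a + 1 - n)) *
      ∫⁻ r in Ioc (0:ℝ) 1, ENNReal.ofReal (r ^ ((1 - s) * (p - 1))) *
        Φ (x + (v + r • ((-1/2:ℝ) • v)), r * ‖v‖) with hT2
  set T3 : EuclideanSpace ℝ (Fin n) → EuclideanSpace ℝ (Fin n) → ℝ≥0∞ := fun x v =>
    ENNReal.ofReal (‖v‖ ^ (a + 1 - n)) * Ψ (x + (1/2:ℝ) • v, ‖v‖) with hT3
  have m1 : Measurable (fun q : EuclideanSpace ℝ (Fin n) × EuclideanSpace ℝ (Fin n) =>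
      T1 q.1 q.2) := by
    apply Measurable.mul (by fun_prop)
    apply Measurable.lintegral_prod_right' (f := fun q : (EuclideanSpace ℝ (Fin n) ×
      EuclideanSpace ℝ (Fin n)) × ℝ => ENNReal.ofReal (q.2 ^ ((1 - s) * (p - 1))) *
        Φ (q.1.1 + q.2 • ((1/2:ℝ) • q.1.2), q.2 * ‖q.1.2‖))
    fun_prop
  have m2 : Measurable (fun q : EuclideanSpace ℝ (Fin n) × EuclideanSpace ℝ (Fin n) =>
      T2 q.1 q.2) := by
    apply Measurable.mul (by fun_prop)
    apply Measurable.lintegral_prod_right' (f := fun q : (EuclideanSpace ℝ (Fin n) ×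
      EuclideanSpace ℝ (Fin n)) × ℝ => ENNReal.ofReal (q.2 ^ ((1 - s) * (p - 1))) *
        Φ (q.1.1 + (q.1.2 + q.2 • ((-1/2:ℝ) • q.1.2)), q.2 * ‖q.1.2‖))
    fun_prop
  have m3 : Measurable (fun q : EuclideanSpace ℝ (Fin n) × EuclideanSpace ℝ (Fin n) =>
      T3 q.1 q.2) := by
    fun_prop
  have hpt : ∀ x v : EuclideanSpace ℝ (Fin n),
      ENNReal.ofReal (‖U (emb x 0) - (Rt x (x + v)) (U (emb (x + v) 0))‖ ^ p
              / ‖x - (x + v)‖ ^ ((n : ℝ) + s * p)) ≤ K * (T1 x v + T2 x v + T3 x v) := by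
    intro x v
    have hxv : ‖x - (x + v)‖ = ‖v‖ := by simp
    rw [hxv]
    rcases eq_or_ne v 0 with rfl | hv
    · have : (n : ℝ) + s * p ≠ 0 := by positivity
      simp [Real.zero_rpow this]
    obtain ⟨P, hP1, hP, hRP⟩ := hRt x (x + v)
    rw [hRP]
    have hb := pointwise_bound Γ DΓ hdΓ hΓ hDΓ hsk β hβ hcurv U DU hU hDU x v P hP1 (by
      intro t ht
      have h := hP t ht
      have e1 : (1 - t) • x + t • (x + v) = x + t • v := by module
      have e2 : x + v - x = v := by simp
      rw [e1, e2] at h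
      exact h)
    have h := pw_ennreal n s p hs0 hs1 hp _ ‖v‖ √β _ (norm_nonneg _) (norm_pos_iff.2 hv)
      (Real.sqrt_nonneg _) (norm_nonneg _)
      (fun r => gDens Γ U DU (x + r • ((1/2:ℝ) • v), r * ‖v‖))
      (fun r => gDens Γ U DU (x + v + r • ((-1/2:ℝ) • v), r * ‖v‖))
      (by fun_prop) (by fun_prop) (fun r => hgn _) (fun r => hgn _) hb
    refine h.trans (le_of_eq ?_)
    simp only [hT1, hT2, hT3, hΦ, hΨ, abs_norm, add_assoc x v, hKdef, ha]
  set J1 := ∫⁻ x : EuclideanSpace ℝ (Fin n), ∫⁻ t in Ioi (0:ℝ), ENNReal.ofReal (t ^ a) * Φ (x, t)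
    with hJ1
  set J2 := ∫⁻ x : EuclideanSpace ℝ (Fin n), ∫⁻ t in Ioi (0:ℝ), ENNReal.ofReal (t ^ a) * Ψ (x, t)
    with hJ2
  have i1 : ∫⁻ x, ∫⁻ v, T1 x v = σ * ENNReal.ofReal (1 / s) * J1 :=
    term_one hn a s p hs0 (by rw [ha]; ring) Φ hΦm (fun q => q.1 • ((1/2:ℝ) • q.2)) (by fun_prop)
  have i2 : ∫⁻ x, ∫⁻ v, T2 x v = σ * ENNReal.ofReal (1 / s) * J1 :=
    term_one hn a s p hs0 (by rw [ha]; ring) Φ hΦm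
      (fun q => q.2 + q.1 • ((-1/2:ℝ) • q.2)) (by fun_prop)
  have i3 : ∫⁻ x, ∫⁻ v, T3 x v = σ * J2 :=
    term_two hn a Ψ hΨm (fun v => (1/2:ℝ) • v) (by fun_prop)
  have hR : (∫⁻ x : EuclideanSpace ℝ (Fin n), ∫⁻ t in Ioi (0:ℝ),
              ENNReal.ofReal
                ((hsNorm (DU (emb x t) + (Γ (emb x t)).flip (U (emb x t))) ^ p
                  + β ^ (p / 2) * ‖U (emb x t)‖ ^ p) / t ^ (1 - (1 - s) * p))) = J1 + J2 := by
    rw [hJ1, hJ2, ← lintegral_add_left (Measurable.lintegral_prod_right'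
      (f := fun q : EuclideanSpace ℝ (Fin n) × ℝ => ENNReal.ofReal (q.2 ^ a) * Φ (q.1, q.2))
      (by fun_prop))]
    refine lintegral_congr fun x => ?_
    rw [← lintegral_add_left (by fun_prop)]
    refine setLIntegral_congr_fun measurableSet_Ioi fun t ht => ?_
    have ht : 0 < t := ht
    have hs : √β ^ p = β ^ (p / 2) := by
      rw [Real.sqrt_eq_rpow, ← Real.rpow_mul hβ]; congr 1; ring
    have hta : t ^ a = (t ^ (1 - (1 - s) * p))⁻¹ := by
      rw [← Real.rpow_neg ht.le, ha]; congr 1; ring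
    have hh0 : 0 ≤ hsNorm (DU (emb x t) + (Γ (emb x t)).flip (U (emb x t))) := Real.sqrt_nonneg _
    simp only [hΦ, hΨ, gDens, abs_of_pos ht]
    rw [ENNReal.ofReal_rpow_of_nonneg hh0 hp0.le, ← mul_add, ← ENNReal.ofReal_add (by positivity)
      (by positivity), ← ENNReal.ofReal_mul (by positivity), hs, hta, div_eq_inv_mul]
  rw [hR]
  clear_value T1 T2 T3 J1 J2 K σ Ct
  calc _ = ∫⁻ x : EuclideanSpace ℝ (Fin n), ∫⁻ v : EuclideanSpace ℝ (Fin n),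
            ENNReal.ofReal (‖U (emb x 0) - (Rt x (x + v)) (U (emb (x + v) 0))‖ ^ p
              / ‖x - (x + v)‖ ^ ((n : ℝ) + s * p)) := by
        refine lintegral_congr fun x => ?_
        rw [← lintegral_add_left_eq_self _ x]
    _ ≤ ∫⁻ x : EuclideanSpace ℝ (Fin n), ∫⁻ v : EuclideanSpace ℝ (Fin n),
            K * (T1 x v + T2 x v + T3 x v) :=
        lintegral_mono fun x => lintegral_mono fun v => hpt x v
    _ = K * (∫⁻ x, ∫⁻ v, T1 x v + T2 x v + T3 x v) := by
        have : ∀ x, ∫⁻ v, K * (T1 x v + T2 x v + T3 x v) =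
            K * ∫⁻ v, T1 x v + T2 x v + T3 x v := fun x => lintegral_const_mul' _ _ hKt
        simp_rw [this]
        exact lintegral_const_mul' _ _ hKt
    _ = K * (∫⁻ x, ∫⁻ v, T1 x v) + K * (∫⁻ x, ∫⁻ v, T2 x v) + K * (∫⁻ x, ∫⁻ v, T3 x v) := by
        have h1 : ∀ x, Measurable (T1 x) := fun x => m1.comp measurable_prodMk_left
        have h2 : ∀ x, Measurable (T2 x) := fun x => m2.comp measurable_prodMk_left
        have n1 : Measurable (fun x => ∫⁻ v, T1 x v) := m1.lintegral_prod_right'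
        have n2 : Measurable (fun x => ∫⁻ v, T2 x v) := m2.lintegral_prod_right'
        have this' : ∫⁻ x, ∫⁻ v, T1 x v + T2 x v + T3 x v =
            (∫⁻ x, ∫⁻ v, T1 x v) + (∫⁻ x, ∫⁻ v, T2 x v) + (∫⁻ x, ∫⁻ v, T3 x v) := by
          have e : ∀ x, ∫⁻ v, T1 x v + T2 x v + T3 x v =
            (∫⁻ v, T1 x v) + (∫⁻ v, T2 x v) + (∫⁻ v, T3 x v) := by
            intro x
            exact lintegral_add3 _ _ _ (h1 x) (h2 x)
          simp_rw [e]
          exact lintegral_add3 _ _ _ n1 n2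
        rw [this', mul_add, mul_add]
    _ ≤ Ct * (J1 + J2) := by
        rw [i1, i2, i3, hCt]
        have e : (K * (σ * ENNReal.ofReal (1 / s) + σ * ENNReal.ofReal (1 / s) + σ) + 1) * (J1 + J2)
          = (K * (σ * ENNReal.ofReal (1 / s) * J1) + K * (σ * ENNReal.ofReal (1 / s) * J1)
            + K * (σ * J2)) + (K * (σ * ENNReal.ofReal (1 / s) + σ * ENNReal.ofReal (1 / s)) * J2
              + K * σ * J1 + (J1 + J2)) := by ring
        rw [e]
        exact le_self_add
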